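/- Let (G, +) be an abelian torsion-free definable group with dim G = n, and suppose G = A₁ ⊕ ⋯ ⊕ A_n for definable subgroups A₁, …, A_n with dim Aᵢ = 1. Then for every definable subgroup H of G: (i) there are definable subgroups H₁, …, H_s of dimension 1 with H = H₁ ⊕ ⋯ ⊕ H_s; (ii) there are definable subgroups B₁, …, B_k of dimension 1 with G = H ⊕ B₁ ⊕ ⋯ ⊕ B_k. -/

import Mathlib

open FirstOrder

namespace OMin

variable (L : FirstOrder.Language) (M : Type) [L.Structure M]

/-- A set of tuples from `M` is *definable* (with arbitrary parameters from `M`). -/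
def Defin {α : Type} (s : Set (α → M)) : Prop :=
  Set.Definable (Set.univ : Set M) L s

section Order

variable [LinearOrder M]

/-- A subset of `M` that is a single point or an open interval. -/
def IsPointOrInterval (s : Set M) : Prop :=
  (∃ a, s = {a}) ∨ (∃ a b, s = Set.Ioo a b) ∨ (∃ a, s = Set.Ioi a) ∨
    (∃ a, s = Set.Iio a) ∨ s = Set.univ

/-- `M` (with the structure of `L` and the order `<`) is an o-minimal structure:
a structure on a dense linear order without endpoints, whose order is definable,
such that every definable subset of `M` is a finite union of points and open intervals. -/
def OMinimal : Prop :=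
  DenselyOrdered M ∧ NoMinOrder M ∧ NoMaxOrder M ∧ Nonempty M ∧
    Defin L M {x : Fin 2 → M | x 0 < x 1} ∧
    ∀ s : Set M, Defin L M {x : Fin 1 → M | x 0 ∈ s} →
      ∃ (n : ℕ) (t : Fin n → Set M), (∀ i, IsPointOrInterval M (t i)) ∧ s = ⋃ i, t i

/-- The order topology on `M`. -/
def otop : TopologicalSpace M := Preorder.topology M

/-- The product of the order topology on tuples. -/
def ptop (k : ℕ) : TopologicalSpace (Fin k → M) :=
  @Pi.topologicalSpace (Fin k) (fun _ => M) (fun _ => otop M)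

/-- A definable set `S` is definably connected iff it is not the union of two disjoint
nonempty definable subsets that are open in `S`. -/
def DefConnected {k : ℕ} (S : Set (Fin k → M)) : Prop :=
  ∀ U V : Set (Fin k → M), Defin L M U → Defin L M V →
    (∃ U', @IsOpen _ (ptop M k) U' ∧ U = U' ∩ S) →
    (∃ V', @IsOpen _ (ptop M k) V' ∧ V = V' ∩ S) →
    U ∪ V = S → U ∩ V = ∅ → (U = ∅ ∨ V = ∅)

/-- `X ⊆ M^k` has dimension at least `n`: some coordinate projection to `M^n` of `X`
has nonempty interior. -/
def DimGE {k : ℕ} (X : Set (Fin k → M)) (n : ℕ) : Prop :=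
  ∃ f : Fin n → Fin k, Function.Injective f ∧
    (@interior _ (ptop M n) ((fun x : Fin k → M => x ∘ f) '' X)).Nonempty

/-- `X` has dimension exactly `n`: `n` is the largest integer such that the image of `X`
under some coordinate projection `M^k → M^n` has nonempty interior. -/
def DimEq {k : ℕ} (X : Set (Fin k → M)) (n : ℕ) : Prop :=
  DimGE M X n ∧ ∀ m : ℕ, DimGE M X m → m ≤ n

end Order

/-- A definable abelian group: a definable set with definable group operations. -/
structure DefAbGroup where
  k : ℕ
  carrier : Set (Fin k → M)
  zero : Fin k → M
  add : (Fin k → M) → (Fin k → M) → (Fin k → M)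
  neg : (Fin k → M) → (Fin k → M)
  zero_mem : zero ∈ carrier
  add_mem : ∀ x ∈ carrier, ∀ y ∈ carrier, add x y ∈ carrier
  neg_mem : ∀ x ∈ carrier, neg x ∈ carrier
  hadd_assoc : ∀ x ∈ carrier, ∀ y ∈ carrier, ∀ z ∈ carrier,
    add (add x y) z = add x (add y z)
  hadd_comm : ∀ x ∈ carrier, ∀ y ∈ carrier, add x y = add y x
  hzero_add : ∀ x ∈ carrier, add zero x = x
  hneg_add : ∀ x ∈ carrier, add (neg x) x = zero
  carrier_def : Defin L M carrier
  add_def : Defin L M {p : (Fin k ⊕ Fin k ⊕ Fin k) → M |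
    (fun i => p (Sum.inl i)) ∈ carrier ∧ (fun i => p (Sum.inr (Sum.inl i))) ∈ carrier ∧
    add (fun i => p (Sum.inl i)) (fun i => p (Sum.inr (Sum.inl i))) =
      fun i => p (Sum.inr (Sum.inr i))}
  neg_def : Defin L M {p : (Fin k ⊕ Fin k) → M |
    (fun i => p (Sum.inl i)) ∈ carrier ∧
    neg (fun i => p (Sum.inl i)) = fun i => p (Sum.inr i)}

/-- A definable (not necessarily unital or commutative) ring: a definable abelian group
together with a definable associative multiplication distributing over the addition. -/
structure DefRing extends DefAbGroup L M where
  mul : (Fin k → M) → (Fin k → M) → (Fin k → M)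
  mul_mem : ∀ x ∈ carrier, ∀ y ∈ carrier, mul x y ∈ carrier
  hmul_assoc : ∀ x ∈ carrier, ∀ y ∈ carrier, ∀ z ∈ carrier,
    mul (mul x y) z = mul x (mul y z)
  hleft_distrib : ∀ x ∈ carrier, ∀ y ∈ carrier, ∀ z ∈ carrier,
    mul x (add y z) = add (mul x y) (mul x z)
  hright_distrib : ∀ x ∈ carrier, ∀ y ∈ carrier, ∀ z ∈ carrier,
    mul (add x y) z = add (mul x z) (mul y z)
  mul_def : Defin L M {p : (Fin k ⊕ Fin k ⊕ Fin k) → M |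
    (fun i => p (Sum.inl i)) ∈ carrier ∧ (fun i => p (Sum.inr (Sum.inl i))) ∈ carrier ∧
    mul (fun i => p (Sum.inl i)) (fun i => p (Sum.inr (Sum.inl i))) =
      fun i => p (Sum.inr (Sum.inr i))}

end OMin
namespace OMin

namespace DefAbGroup

variable {L : FirstOrder.Language} {M : Type} [L.Structure M] (G : DefAbGroup L M)

/-- `n • x` in the group `G`. -/
def nsmul : ℕ → (Fin G.k → M) → (Fin G.k → M)
  | 0, _ => G.zero
  | n + 1, x => G.add x (nsmul n x)

/-- Sum of a list of elements. -/
def listSum : List (Fin G.k → M) → (Fin G.k → M)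
  | [] => G.zero
  | x :: l => G.add x (listSum l)

/-- Sum of a finitely indexed family of elements. -/
noncomputable def univSum {ι : Type} [Fintype ι] (f : ι → (Fin G.k → M)) : Fin G.k → M :=
  G.listSum ((Finset.univ : Finset ι).toList.map f)

/-- `S` is a subgroup of `G`. -/
def IsSubgroup (S : Set (Fin G.k → M)) : Prop :=
  S ⊆ G.carrier ∧ G.zero ∈ S ∧ (∀ x ∈ S, ∀ y ∈ S, G.add x y ∈ S) ∧ ∀ x ∈ S, G.neg x ∈ S

/-- The `n`-torsion subgroup `{x : n • x = 0}`. -/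
def torsion (n : ℕ) : Set (Fin G.k → M) :=
  {x | x ∈ G.carrier ∧ G.nsmul n x = G.zero}

/-- The elements of `S` have no (nontrivial) torsion. -/
def TorsionFreeOn (S : Set (Fin G.k → M)) : Prop :=
  ∀ x ∈ S, ∀ n : ℕ, G.nsmul (n + 1) x = G.zero → x = G.zero

/-- The group `G` is torsion-free. -/
def TorsionFree : Prop := G.TorsionFreeOn G.carrier

/-- The set `S` is the internal direct sum of the family `I` of subgroups of `G`:
every element of `S` is uniquely the sum of a family of elements of the `I i`. -/
def IsInternalDirectSumOn {ι : Type} [Fintype ι] (S : Set (Fin G.k → M))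
    (I : ι → Set (Fin G.k → M)) : Prop :=
  (∀ i, G.IsSubgroup (I i) ∧ I i ⊆ S) ∧
  (∀ x ∈ S, ∃ f : ι → (Fin G.k → M), (∀ i, f i ∈ I i) ∧ G.univSum f = x) ∧
  (∀ f g : ι → (Fin G.k → M), (∀ i, f i ∈ I i) → (∀ i, g i ∈ I i) →
    G.univSum f = G.univSum g → f = g)

/-- `G` is the internal direct sum of the family `I` of subgroups. -/
def IsInternalDirectSum {ι : Type} [Fintype ι] (I : ι → Set (Fin G.k → M)) : Prop :=
  G.IsInternalDirectSumOn G.carrier I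

section Order

variable [LinearOrder M]

/-- `C` is the definably connected component of `0` in `G`, i.e. the largest
definably connected definable subgroup of `G`. -/
def IsZeroComponent (C : Set (Fin G.k → M)) : Prop :=
  G.IsSubgroup C ∧ Defin L M C ∧ DefConnected L M C ∧
    ∀ D, G.IsSubgroup D → Defin L M D → DefConnected L M D → D ⊆ C

/-- `N` is the maximal definable torsion-free subgroup of `G`. -/
def IsMaxDefTorsionFree (N : Set (Fin G.k → M)) : Prop :=
  G.IsSubgroup N ∧ Defin L M N ∧ G.TorsionFreeOn N ∧
    ∀ D, G.IsSubgroup D → Defin L M D → G.TorsionFreeOn D → D ⊆ N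

end Order

end DefAbGroup

namespace DefRing

variable {L : FirstOrder.Language} {M : Type} [L.Structure M] (R : DefRing L M)

/-- `R` is a null ring: all products vanish. -/
def IsNull : Prop := ∀ x ∈ R.carrier, ∀ y ∈ R.carrier, R.mul x y = R.zero

/-- The multiplication of `R` restricted to `S` is trivial. -/
def NullOn (S : Set (Fin R.k → M)) : Prop := ∀ x ∈ S, ∀ y ∈ S, R.mul x y = R.zero

/-- The two-sided annihilator of `X` in `R`. -/
def annOf (X : Set (Fin R.k → M)) : Set (Fin R.k → M) :=
  {a | a ∈ R.carrier ∧ ∀ x ∈ X, R.mul a x = R.zero ∧ R.mul x a = R.zero}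

/-- `Ann(R)`, the two-sided annihilator of `R`. -/
def ann : Set (Fin R.k → M) := R.annOf R.carrier

/-- `powSucc x n = x^(n+1)`. -/
def powSucc (x : Fin R.k → M) : ℕ → (Fin R.k → M)
  | 0 => x
  | n + 1 => R.mul (powSucc x n) x

/-- `upow e x n = x^n`, where `x^0 = e` (for a unital ring with identity `e`). -/
def upow (e x : Fin R.k → M) : ℕ → (Fin R.k → M)
  | 0 => e
  | n + 1 => R.mul (upow e x n) x

/-- `products S n` is the set of all products of `n` elements of `S` (for `n ≥ 1`;
by convention `products S 0 = {0}`). -/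
def products (S : Set (Fin R.k → M)) : ℕ → Set (Fin R.k → M)
  | 0 => {R.zero}
  | 1 => S
  | n + 2 => {z | ∃ x ∈ S, ∃ y ∈ products S (n + 1), z = R.mul x y}

/-- `R` is a nilpotent ring: all products of some fixed length vanish. -/
def IsNilpotentRing : Prop := ∃ m, 1 ≤ m ∧ R.products R.carrier m = {R.zero}

/-- `R` is a nil ring: every element is nilpotent. -/
def IsNilRing : Prop := ∀ x ∈ R.carrier, ∃ m : ℕ, R.powSucc x m = R.zero

/-- The set `I` is nilpotent: all products of some fixed length of elements of `I` vanish. -/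
def NilpotentSet (I : Set (Fin R.k → M)) : Prop := ∃ m, 1 ≤ m ∧ R.products I m = {R.zero}

/-- `I` is a left ideal of `R`. -/
def IsLeftIdeal (I : Set (Fin R.k → M)) : Prop :=
  R.IsSubgroup I ∧ ∀ r ∈ R.carrier, ∀ x ∈ I, R.mul r x ∈ I

/-- `I` is a right ideal of `R`. -/
def IsRightIdeal (I : Set (Fin R.k → M)) : Prop :=
  R.IsSubgroup I ∧ ∀ r ∈ R.carrier, ∀ x ∈ I, R.mul x r ∈ I

/-- `I` is a two-sided ideal of `R`. -/
def IsIdeal (I : Set (Fin R.k → M)) : Prop :=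
  R.IsSubgroup I ∧ ∀ r ∈ R.carrier, ∀ x ∈ I, R.mul r x ∈ I ∧ R.mul x r ∈ I

/-- The Jacobson radical of `R`:
`J(R) = {a ∈ R : ∀ r ∈ R, ∃ b ∈ R, b·r·a − r·a − b = 0}`. -/
def jacobson : Set (Fin R.k → M) :=
  {a | a ∈ R.carrier ∧ ∀ r ∈ R.carrier, ∃ b ∈ R.carrier,
    R.add (R.mul (R.mul b r) a) (R.add (R.neg (R.mul r a)) (R.neg b)) = R.zero}

/-- `R` is semiprime: `{0}` is its only nilpotent two-sided ideal. -/
def IsSemiprime : Prop := ∀ I, R.IsIdeal I → R.NilpotentSet I → I = {R.zero}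

/-- `R` is prime: `aRb ≠ {0}` whenever `a, b ≠ 0`. -/
def IsPrimeRing : Prop := ∀ a ∈ R.carrier, a ≠ R.zero → ∀ b ∈ R.carrier, b ≠ R.zero →
    ∃ r ∈ R.carrier, R.mul (R.mul a r) b ≠ R.zero

/-- `R` is simple: nontrivial multiplication and no nontrivial proper two-sided ideals. -/
def IsSimple : Prop := (¬ R.IsNull) ∧ ∀ I, R.IsIdeal I → I = {R.zero} ∨ I = R.carrier

/-- `R` is definably simple: nontrivial multiplication and no nontrivial proper
*definable* two-sided ideals. -/
def IsDefSimple : Prop :=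
  (¬ R.IsNull) ∧ ∀ I, R.IsIdeal I → Defin L M I → I = {R.zero} ∨ I = R.carrier

/-- `e` is a (two-sided) multiplicative identity of `R`. -/
def IsIdentity (e : Fin R.k → M) : Prop :=
  e ∈ R.carrier ∧ ∀ x ∈ R.carrier, R.mul e x = x ∧ R.mul x e = x

/-- `R` is unital. -/
def IsUnital : Prop := ∃ e, R.IsIdentity e

/-- `R` is a division ring. -/
def IsDivisionRing : Prop :=
  ∃ e, R.IsIdentity e ∧ e ≠ R.zero ∧ ∀ x ∈ R.carrier, x ≠ R.zero →
    ∃ y ∈ R.carrier, R.mul x y = e ∧ R.mul y x = e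

theorem IsDivisionRing.unital {R : DefRing L M} (h : R.IsDivisionRing) : R.IsUnital :=
  h.imp fun _ he => he.1

/-- `S` is a subring (as a subset, not necessarily definable). -/
def IsSubringSet (S : Set (Fin R.k → M)) : Prop :=
  S ⊆ R.carrier ∧ R.zero ∈ S ∧ (∀ x ∈ S, ∀ y ∈ S, R.add x y ∈ S) ∧
    (∀ x ∈ S, R.neg x ∈ S) ∧ ∀ x ∈ S, ∀ y ∈ S, R.mul x y ∈ S

/-- `S` is a definable subring of `R`. -/
def IsDefSubring (S : Set (Fin R.k → M)) : Prop :=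
  Defin L M S ∧ R.IsSubringSet S

/-- `S` is the smallest definable subring of `R` containing `x`. -/
def IsSmallestDefSubringContaining (x : Fin R.k → M) (S : Set (Fin R.k → M)) : Prop :=
  R.IsDefSubring S ∧ x ∈ S ∧ ∀ T, R.IsDefSubring T → x ∈ T → S ⊆ T

/-- `e` is an idempotent element of `R`. -/
def IsIdempotent (e : Fin R.k → M) : Prop := e ∈ R.carrier ∧ R.mul e e = e

/-- `a` and `b` are orthogonal: `a·b = b·a = 0`. -/
def Orthogonal (a b : Fin R.k → M) : Prop := R.mul a b = R.zero ∧ R.mul b a = R.zero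

/-- `e` is a primitive idempotent: a nonzero idempotent that is not the sum of two
nonzero orthogonal idempotents. -/
def IsPrimitiveIdempotent (e : Fin R.k → M) : Prop :=
  R.IsIdempotent e ∧ e ≠ R.zero ∧
    ¬ ∃ a b, R.IsIdempotent a ∧ R.IsIdempotent b ∧ a ≠ R.zero ∧ b ≠ R.zero ∧
      R.Orthogonal a b ∧ R.add a b = e

/-- The set `R·e`. -/
def leftMulSet (e : Fin R.k → M) : Set (Fin R.k → M) :=
  {z | ∃ r ∈ R.carrier, z = R.mul r e}

/-- The set `e·R`. -/
def rightMulSet (e : Fin R.k → M) : Set (Fin R.k → M) :=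
  {z | ∃ r ∈ R.carrier, z = R.mul e r}

/-- The set `e·R·f`. -/
def midMulSet (e f : Fin R.k → M) : Set (Fin R.k → M) :=
  {z | ∃ r ∈ R.carrier, z = R.mul e (R.mul r f)}

/-- `I` is a minimal left ideal. -/
def IsMinimalLeftIdeal (I : Set (Fin R.k → M)) : Prop :=
  R.IsLeftIdeal I ∧ I ≠ {R.zero} ∧ ∀ J, R.IsLeftIdeal J → J ⊆ I → J = {R.zero} ∨ J = I

/-- `I` is a minimal right ideal. -/
def IsMinimalRightIdeal (I : Set (Fin R.k → M)) : Prop :=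
  R.IsRightIdeal I ∧ I ≠ {R.zero} ∧ ∀ J, R.IsRightIdeal J → J ⊆ I → J = {R.zero} ∨ J = I

/-- `R` is left Artinian: every descending chain of left ideals stabilizes. -/
def LeftArtinian : Prop :=
  ∀ f : ℕ → Set (Fin R.k → M), (∀ n, R.IsLeftIdeal (f n)) → (∀ n, f (n + 1) ⊆ f n) →
    ∃ N, ∀ n, N ≤ n → f n = f N

/-- `J` is a two-sided ideal of the (sub)ring `S`. -/
def IsIdealOn (S J : Set (Fin R.k → M)) : Prop :=
  J ⊆ S ∧ R.zero ∈ J ∧ (∀ x ∈ J, ∀ y ∈ J, R.add x y ∈ J) ∧ (∀ x ∈ J, R.neg x ∈ J) ∧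
    ∀ r ∈ S, ∀ x ∈ J, R.mul r x ∈ J ∧ R.mul x r ∈ J

/-- The (sub)ring `S` is a simple ring. -/
def SimpleOn (S : Set (Fin R.k → M)) : Prop :=
  (¬ R.NullOn S) ∧ ∀ J, R.IsIdealOn S J → J = {R.zero} ∨ J = S

/-- The (sub)ring `S` is a division ring. -/
def DivisionOn (S : Set (Fin R.k → M)) : Prop :=
  ∃ e ∈ S, e ≠ R.zero ∧ (∀ x ∈ S, R.mul e x = x ∧ R.mul x e = x) ∧
    ∀ x ∈ S, x ≠ R.zero → ∃ y ∈ S, R.mul x y = e ∧ R.mul y x = e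

/-- `R` is a (commutative) field. -/
def IsFieldRing : Prop :=
  (∀ x ∈ R.carrier, ∀ y ∈ R.carrier, R.mul x y = R.mul y x) ∧
  ∃ e, R.IsIdentity e ∧ e ≠ R.zero ∧
    ∀ x ∈ R.carrier, x ≠ R.zero → ∃ y ∈ R.carrier, R.mul x y = e

/-- Evaluation of the polynomial `∑_{i ≤ n} c i * X^i` at `x` (`e` the identity). -/
def polyEval (e x : Fin R.k → M) (c : ℕ → (Fin R.k → M)) (n : ℕ) : Fin R.k → M :=
  R.listSum ((List.range (n + 1)).map fun i => R.mul (c i) (R.upow e x i))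

/-- `R` is a real closed field: a field together with a linear order making it an
ordered field in which nonnegative elements are squares and every odd-degree polynomial
has a root. -/
def IsRealClosedDefField : Prop :=
  R.IsFieldRing ∧
  ∃ e, R.IsIdentity e ∧
  ∃ lt : (Fin R.k → M) → (Fin R.k → M) → Prop,
    (∀ x ∈ R.carrier, ¬ lt x x) ∧
    (∀ x ∈ R.carrier, ∀ y ∈ R.carrier, ∀ z ∈ R.carrier, lt x y → lt y z → lt x z) ∧
    (∀ x ∈ R.carrier, ∀ y ∈ R.carrier, x ≠ y → lt x y ∨ lt y x) ∧
    (∀ x ∈ R.carrier, ∀ y ∈ R.carrier, ∀ z ∈ R.carrier, lt x y →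
      lt (R.add x z) (R.add y z)) ∧
    (∀ x ∈ R.carrier, ∀ y ∈ R.carrier, lt R.zero x → lt R.zero y → lt R.zero (R.mul x y)) ∧
    (∀ x ∈ R.carrier, ¬ lt x R.zero → ∃ y ∈ R.carrier, R.mul y y = x) ∧
    (∀ n : ℕ, Odd n → ∀ c : ℕ → (Fin R.k → M), (∀ i, i ≤ n → c i ∈ R.carrier) →
      c n ≠ R.zero → ∃ x ∈ R.carrier, R.polyEval e x c n = R.zero)

end DefRing

/-- A definable isomorphism of definable rings: a ring isomorphism whose graph is
definable. -/
def DefIso {L : FirstOrder.Language} {M : Type} [L.Structure M] (A B : DefRing L M) : Prop :=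
  ∃ f : (Fin A.k → M) → (Fin B.k → M),
    Set.BijOn f A.carrier B.carrier ∧
    (∀ x ∈ A.carrier, ∀ y ∈ A.carrier,
      f (A.add x y) = B.add (f x) (f y) ∧ f (A.mul x y) = B.mul (f x) (f y)) ∧
    Defin L M {p : (Fin A.k ⊕ Fin B.k) → M |
      (fun i => p (Sum.inl i)) ∈ A.carrier ∧
      f (fun i => p (Sum.inl i)) = fun i => p (Sum.inr i)}

end OMin
namespace OMin

/-- The language of rings with only the two binary operations `+` and `·`. -/
def ringLang : FirstOrder.Language :=
  ⟨fun n => match n with | 2 => Bool | _ => Empty, fun _ => Empty⟩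

namespace DefRing

variable {L : FirstOrder.Language} {M : Type} [L.Structure M] (R : DefRing L M)

/-- The ring structure `(R, +, ·)` as a first-order structure on the carrier of `R`. -/
def innerStr : ringLang.Structure ↥R.carrier where
  funMap {n} f x :=
    match n, f, x with
    | 2, b, x =>
      if (show Bool from b) then ⟨R.add ↑(x 0) ↑(x 1), R.add_mem _ (x 0).2 _ (x 1).2⟩
      else ⟨R.mul ↑(x 0) ↑(x 1), R.mul_mem _ (x 0).2 _ (x 1).2⟩
    | 0, f, _ => f.elim
    | 1, f, _ => f.elim
    | _ + 3, f, _ => f.elim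
  RelMap {n} r _ := r.elim

/-- A set of tuples from the carrier of `R` that is definable in the pure ring
structure `(R, +, ·)`. -/
def InnerDefinable {α : Type} (S : Set (α → ↥R.carrier)) : Prop :=
  letI := R.innerStr
  Set.Definable (Set.univ : Set ↥R.carrier) ringLang S

/-- A subset of `R` that is definable in the pure ring structure `(R, +, ·)`. -/
def InnerDefinableSubset (S : Set (Fin R.k → M)) : Prop :=
  S ⊆ R.carrier ∧
    R.InnerDefinable {x : Fin 1 → ↥R.carrier | ((x 0 : ↥R.carrier) : Fin R.k → M) ∈ S}

variable {R}

theorem add_zero' {x : Fin R.k → M} (hx : x ∈ R.carrier) : R.add x R.zero = x := by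
  rw [R.hadd_comm x hx R.zero R.zero_mem]; exact R.hzero_add x hx

theorem add_neg' {x : Fin R.k → M} (hx : x ∈ R.carrier) : R.add x (R.neg x) = R.zero := by
  rw [R.hadd_comm x hx (R.neg x) (R.neg_mem x hx)]; exact R.hneg_add x hx

theorem add_left_cancel' {a b c : Fin R.k → M}
    (ha : a ∈ R.carrier) (hb : b ∈ R.carrier) (hc : c ∈ R.carrier)
    (h : R.add a b = R.add a c) : b = c := by
  have hna := R.neg_mem a ha
  calc b = R.add R.zero b := (R.hzero_add b hb).symm
    _ = R.add (R.add (R.neg a) a) b := by rw [R.hneg_add a ha]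
    _ = R.add (R.neg a) (R.add a b) := R.hadd_assoc _ hna _ ha _ hb
    _ = R.add (R.neg a) (R.add a c) := by rw [h]
    _ = R.add (R.add (R.neg a) a) c := (R.hadd_assoc _ hna _ ha _ hc).symm
    _ = R.add R.zero c := by rw [R.hneg_add a ha]
    _ = c := R.hzero_add c hc

theorem zero_mul' {x : Fin R.k → M} (hx : x ∈ R.carrier) : R.mul R.zero x = R.zero := by
  have h0 := R.zero_mem
  have hm := R.mul_mem _ h0 _ hx
  apply add_left_cancel' hm hm h0
  calc R.add (R.mul R.zero x) (R.mul R.zero x)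
      = R.mul (R.add R.zero R.zero) x := (R.hright_distrib _ h0 _ h0 _ hx).symm
    _ = R.mul R.zero x := by rw [R.hzero_add _ h0]
    _ = R.add (R.mul R.zero x) R.zero := (add_zero' hm).symm

theorem mul_zero' {x : Fin R.k → M} (hx : x ∈ R.carrier) : R.mul x R.zero = R.zero := by
  have h0 := R.zero_mem
  have hm := R.mul_mem _ hx _ h0
  apply add_left_cancel' hm hm h0
  calc R.add (R.mul x R.zero) (R.mul x R.zero)
      = R.mul x (R.add R.zero R.zero) := (R.hleft_distrib _ hx _ h0 _ h0).symm
    _ = R.mul x R.zero := by rw [R.hzero_add _ h0]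
    _ = R.add (R.mul x R.zero) R.zero := (add_zero' hm).symm

variable (R)

/-- The addition on the carrier of a definable ring. -/
def addSub : Add ↥R.carrier := ⟨fun a b => ⟨R.add a b, R.add_mem _ a.2 _ b.2⟩⟩

/-- The zero of the carrier of a definable ring. -/
def zeroSub : Zero ↥R.carrier := ⟨⟨R.zero, R.zero_mem⟩⟩

/-- The negation on the carrier of a definable ring. -/
def negSub : Neg ↥R.carrier := ⟨fun a => ⟨R.neg a, R.neg_mem _ a.2⟩⟩

/-- The unital ring structure on the carrier of a unital definable ring. -/
noncomputable def ringSub (h : R.IsUnital) : Ring ↥R.carrier := by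
  letI := R.addSub; letI := R.zeroSub; letI := R.negSub
  exact
  { add := fun a b => ⟨R.add a b, R.add_mem _ a.2 _ b.2⟩
    add_assoc := fun a b c => Subtype.ext (R.hadd_assoc _ a.2 _ b.2 _ c.2)
    zero := ⟨R.zero, R.zero_mem⟩
    zero_add := fun a => Subtype.ext (R.hzero_add _ a.2)
    add_zero := fun a => Subtype.ext (add_zero' a.2)
    add_comm := fun a b => Subtype.ext (R.hadd_comm _ a.2 _ b.2)
    neg := fun a => ⟨R.neg a, R.neg_mem _ a.2⟩
    neg_add_cancel := fun a => Subtype.ext (R.hneg_add _ a.2)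
    nsmul := nsmulRec
    zsmul := zsmulRec
    mul := fun a b => ⟨R.mul a b, R.mul_mem _ a.2 _ b.2⟩
    mul_assoc := fun a b c => Subtype.ext (R.hmul_assoc _ a.2 _ b.2 _ c.2)
    one := ⟨Classical.choose h, (Classical.choose_spec h).1⟩
    one_mul := fun a => Subtype.ext (((Classical.choose_spec h).2 _ a.2).1)
    mul_one := fun a => Subtype.ext (((Classical.choose_spec h).2 _ a.2).2)
    left_distrib := fun a b c => Subtype.ext (R.hleft_distrib _ a.2 _ b.2 _ c.2)
    right_distrib := fun a b c => Subtype.ext (R.hright_distrib _ a.2 _ b.2 _ c.2)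
    zero_mul := fun a => Subtype.ext (zero_mul' a.2)
    mul_zero := fun a => Subtype.ext (mul_zero' a.2)
    nsmul_zero := fun a => rfl
    nsmul_succ := fun n a => rfl
    zsmul_zero' := fun a => rfl
    zsmul_succ' := fun n a => rfl
    zsmul_neg' := fun n a => rfl }

theorem IsFieldRing.unital {R : DefRing L M} (h : R.IsFieldRing) : R.IsUnital :=
  h.2.imp fun _ he => he.1

/-- The commutative ring structure on the carrier of a definable field. -/
noncomputable def commRingSub (h : R.IsFieldRing) : CommRing ↥R.carrier :=
  { R.ringSub h.unital with
    mul_comm := fun a b => by exact Subtype.ext (h.1 _ a.2 _ b.2) }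

end DefRing

end OMin
namespace OMin

/-- `K(√-1)`: the quadratic extension `K[X]/(X² + 1)` of `K`, realized concretely
on pairs. -/
structure Gauss (K : Type) where
  re : K
  im : K

namespace Gauss

variable {K : Type} [CommRing K]

@[ext] theorem ext {a b : Gauss K} (h1 : a.re = b.re) (h2 : a.im = b.im) : a = b := by
  cases a; cases b; cases h1; cases h2; rfl

instance : Add (Gauss K) := ⟨fun a b => ⟨a.re + b.re, a.im + b.im⟩⟩
instance : Mul (Gauss K) := ⟨fun a b => ⟨a.re * b.re - a.im * b.im, a.re * b.im + a.im * b.re⟩⟩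
instance : Neg (Gauss K) := ⟨fun a => ⟨-a.re, -a.im⟩⟩
instance : Zero (Gauss K) := ⟨⟨0, 0⟩⟩
instance : One (Gauss K) := ⟨⟨1, 0⟩⟩

@[simp] theorem add_re (a b : Gauss K) : (a + b).re = a.re + b.re := rfl
@[simp] theorem add_im (a b : Gauss K) : (a + b).im = a.im + b.im := rfl
@[simp] theorem mul_re (a b : Gauss K) : (a * b).re = a.re * b.re - a.im * b.im := rfl
@[simp] theorem mul_im (a b : Gauss K) : (a * b).im = a.re * b.im + a.im * b.re := rfl
@[simp] theorem neg_re (a : Gauss K) : (-a).re = -a.re := rfl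
@[simp] theorem neg_im (a : Gauss K) : (-a).im = -a.im := rfl
@[simp] theorem zero_re : (0 : Gauss K).re = 0 := rfl
@[simp] theorem zero_im : (0 : Gauss K).im = 0 := rfl
@[simp] theorem one_re : (1 : Gauss K).re = 1 := rfl
@[simp] theorem one_im : (1 : Gauss K).im = 0 := rfl

instance : CommRing (Gauss K) where
  add := (· + ·)
  add_assoc a b c := by ext <;> simp <;> ring
  zero := 0
  zero_add a := by ext <;> simp
  add_zero a := by ext <;> simp
  add_comm a b := by ext <;> simp <;> ring
  neg := Neg.neg
  neg_add_cancel a := by ext <;> simp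
  nsmul := nsmulRec
  zsmul := zsmulRec
  mul := (· * ·)
  mul_assoc a b c := by ext <;> simp <;> ring
  one := 1
  one_mul a := by ext <;> simp
  mul_one a := by ext <;> simp
  left_distrib a b c := by ext <;> simp <;> ring
  right_distrib a b c := by ext <;> simp <;> ring
  zero_mul a := by ext <;> simp
  mul_zero a := by ext <;> simp
  mul_comm a b := by ext <;> simp <;> ring

end Gauss

variable {L : FirstOrder.Language} {M : Type} [L.Structure M]

/-- An abstract field `F` isomorphic (as a ring, via `iso`) to the definable field `K`,
together with a finite-dimensional associative `F`-algebra `A` with nontrivial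
multiplication and a (set-level) ring isomorphism `aiso` from the subring `S` of the
definable ring `R` onto `A`. -/
structure AlgebraCopy (K : DefRing L M) (R : DefRing L M) (S : Set (Fin R.k → M)) where
  F : Type
  [fieldF : Field F]
  iso : (Fin K.k → M) → F
  bij : Set.BijOn iso K.carrier Set.univ
  map_add : ∀ x ∈ K.carrier, ∀ y ∈ K.carrier, iso (K.add x y) = iso x + iso y
  map_mul : ∀ x ∈ K.carrier, ∀ y ∈ K.carrier, iso (K.mul x y) = iso x * iso y
  A : Type
  [ringA : NonUnitalRing A]
  [moduleA : Module F A]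
  [towerA : IsScalarTower F A A]
  [commA : SMulCommClass F A A]
  findim : FiniteDimensional F A
  notNull : ∃ a b : A, a * b ≠ 0
  aiso : (Fin R.k → M) → A
  abij : Set.BijOn aiso S Set.univ
  amap_add : ∀ x ∈ S, ∀ y ∈ S, aiso (R.add x y) = aiso x + aiso y
  amap_mul : ∀ x ∈ S, ∀ y ∈ S, aiso (R.mul x y) = aiso x * aiso y

/-- The (abstract) ring `A` has nontrivial multiplication, i.e. is not a null ring. -/
def NotNullCarrier (A : Type) [NonUnitalRing A] : Prop := ∃ a b : A, a * b ≠ 0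

/-- A finite-dimensional associative `F`-algebra `A` and a ring isomorphism from the
definable ring `R` onto the direct product `A × B`, for a definable ring `B`. -/
structure ProdSplit (F : Type) [Field F] (R : DefRing L M) (B : DefRing L M) where
  A : Type
  [ringA : NonUnitalRing A]
  [moduleA : Module F A]
  [towerA : IsScalarTower F A A]
  [commA : SMulCommClass F A A]
  findim : FiniteDimensional F A
  f : (Fin R.k → M) → A × (Fin B.k → M)
  bij : Set.BijOn f R.carrier {p | p.2 ∈ B.carrier}
  map_add : ∀ x ∈ R.carrier, ∀ y ∈ R.carrier,
    f (R.add x y) = ((f x).1 + (f y).1, B.add (f x).2 (f y).2)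
  map_mul : ∀ x ∈ R.carrier, ∀ y ∈ R.carrier,
    f (R.mul x y) = ((f x).1 * (f y).1, B.mul (f x).2 (f y).2)

/-- `D` (a definable ring in `M`) is a copy, via the canonical flattening of tuples,
of the ring `Din`, which is definable in the pure ring structure `(B, +, ·)`. -/
def IsInnerCopy (B : DefRing L M) (Din : @DefRing ringLang ↥B.carrier B.innerStr)
    (D : DefRing L M) : Prop :=
  letI := B.innerStr
  ∃ e : Fin D.k ≃ (Fin Din.k × Fin B.k),
    ∃ g : (Fin Din.k → ↥B.carrier) → (Fin D.k → M),
      (∀ x i, g x i = (x (e i).1 : Fin B.k → M) (e i).2) ∧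
      Set.BijOn g Din.carrier D.carrier ∧
      ∀ x ∈ Din.carrier, ∀ y ∈ Din.carrier,
        g (Din.add x y) = D.add (g x) (g y) ∧ g (Din.mul x y) = D.mul (g x) (g y)

/-- `R` is definably isomorphic to the ring `M_n(D)` of `n × n` matrices over the
definable division ring `D`. -/
def MatrixIso (R D : DefRing L M) (hD : D.IsUnital) (n : ℕ) : Prop :=
  letI := D.ringSub hD
  ∃ f : (Fin R.k → M) → Matrix (Fin n) (Fin n) ↥D.carrier,
    Set.BijOn f R.carrier Set.univ ∧
    (∀ x ∈ R.carrier, ∀ y ∈ R.carrier,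
      f (R.add x y) = f x + f y ∧ f (R.mul x y) = f x * f y) ∧
    Defin L M {p : (Fin R.k ⊕ Fin n × Fin n × Fin D.k) → M |
      (fun i => p (Sum.inl i)) ∈ R.carrier ∧
      ∀ q : Fin n × Fin n × Fin D.k,
        ((f (fun i => p (Sum.inl i)) q.1 q.2.1 : ↥D.carrier) : Fin D.k → M) q.2.2 =
          p (Sum.inr q)}

/-- A definable scalar multiplication of the definable field `K` on the subset `S` of the
definable ring `R` making `S` a definable `K`-vector space. -/
def IsDefVectorSpaceOn (K R : DefRing L M) (S : Set (Fin R.k → M))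
    (σ : (Fin K.k → M) → (Fin R.k → M) → (Fin R.k → M)) : Prop :=
  (∀ c ∈ K.carrier, ∀ x ∈ S, σ c x ∈ S) ∧
  Defin L M {p : (Fin K.k ⊕ Fin R.k ⊕ Fin R.k) → M |
    (fun i => p (Sum.inl i)) ∈ K.carrier ∧ (fun i => p (Sum.inr (Sum.inl i))) ∈ S ∧
    σ (fun i => p (Sum.inl i)) (fun i => p (Sum.inr (Sum.inl i))) =
      fun i => p (Sum.inr (Sum.inr i))} ∧
  (∀ e, K.IsIdentity e → ∀ x ∈ S, σ e x = x) ∧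
  (∀ c ∈ K.carrier, ∀ x ∈ S, ∀ y ∈ S, σ c (R.add x y) = R.add (σ c x) (σ c y)) ∧
  (∀ c ∈ K.carrier, ∀ d ∈ K.carrier, ∀ x ∈ S, σ (K.add c d) x = R.add (σ c x) (σ d x)) ∧
  (∀ c ∈ K.carrier, ∀ d ∈ K.carrier, ∀ x ∈ S, σ (K.mul c d) x = σ c (σ d x))

/-- The subring `S` of `R` is a definable `K`-vector space and a definable associative
`K`-algebra. -/
def IsDefAlgebraOn (K R : DefRing L M) (S : Set (Fin R.k → M)) : Prop :=
  ∃ σ, IsDefVectorSpaceOn K R S σ ∧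
    ∀ r ∈ K.carrier, ∀ s ∈ K.carrier, ∀ u ∈ S, ∀ v ∈ S,
      R.mul (σ r u) (σ s v) = σ (K.mul r s) (R.mul u v)

/-- `S` (a subring of the definable ring `R`) is definably isomorphic to
`K^r × K(√-1)^p × ℍ(K)^q`, for the definable field `K`. -/
def GaussQuatIso (R : DefRing L M) (S : Set (Fin R.k → M)) (K : DefRing L M)
    (hK : K.IsFieldRing) (r p q : ℕ) : Prop :=
  letI := K.commRingSub hK
  ∃ f : (Fin R.k → M) →
      ((Fin r → ↥K.carrier) × (Fin p → Gauss ↥K.carrier) × (Fin q → Quaternion ↥K.carrier)),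
    Set.BijOn f S Set.univ ∧
    (∀ x ∈ S, ∀ y ∈ S, f (R.add x y) = f x + f y ∧ f (R.mul x y) = f x * f y) ∧
    Defin L M {pp : (Fin R.k ⊕
        ((Fin r × Fin K.k) ⊕ (Fin p × Fin 2 × Fin K.k) ⊕ (Fin q × Fin 4 × Fin K.k))) → M |
      (fun i => pp (Sum.inl i)) ∈ S ∧
      (∀ (a : Fin r) (c : Fin K.k),
        (((f (fun i => pp (Sum.inl i))).1 a : Fin K.k → M)) c =
          pp (Sum.inr (Sum.inl (a, c)))) ∧
      (∀ (a : Fin p) (c : Fin K.k),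
        ((((f (fun i => pp (Sum.inl i))).2.1 a).re : Fin K.k → M)) c =
            pp (Sum.inr (Sum.inr (Sum.inl (a, 0, c)))) ∧
        ((((f (fun i => pp (Sum.inl i))).2.1 a).im : Fin K.k → M)) c =
            pp (Sum.inr (Sum.inr (Sum.inl (a, 1, c))))) ∧
      (∀ (a : Fin q) (c : Fin K.k),
        ((((f (fun i => pp (Sum.inl i))).2.2 a).re : Fin K.k → M)) c =
            pp (Sum.inr (Sum.inr (Sum.inr (a, 0, c)))) ∧
        ((((f (fun i => pp (Sum.inl i))).2.2 a).imI : Fin K.k → M)) c =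
            pp (Sum.inr (Sum.inr (Sum.inr (a, 1, c)))) ∧
        ((((f (fun i => pp (Sum.inl i))).2.2 a).imJ : Fin K.k → M)) c =
            pp (Sum.inr (Sum.inr (Sum.inr (a, 2, c)))) ∧
        ((((f (fun i => pp (Sum.inl i))).2.2 a).imK : Fin K.k → M)) c =
            pp (Sum.inr (Sum.inr (Sum.inr (a, 3, c)))))}

end OMin
namespace OMin

section DefinableSpaces

/-- An interpretable set: a type whose elements have codes in `M ^ Code`, such that the relation
of coding the same element is definable. -/
class DSp (L : FirstOrder.Language) (M : Type) [L.Structure M] (X : Type) where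
  Code : Type
  finite : Finite Code
  code : (Code → M) → X → Prop
  exists_code : ∀ x, ∃ a, code a x
  code_unique : ∀ {a x y}, code a x → code a y → x = y
  definable_eq : Defin L M {c : Code ⊕ Code → M | ∃ x, code (c ∘ Sum.inl) x ∧ code (c ∘ Sum.inr) x}

attribute [instance] DSp.finite

variable (L : FirstOrder.Language) (M : Type) [L.Structure M]

/-- The index type of the codes of elements of an interpretable set. -/
abbrev DCode (X : Type) [h : DSp L M X] : Type := h.Code

/-- The coding relation of an interpretable set. -/
abbrev dcode {M : Type} [L.Structure M] {X : Type} [h : DSp L M X] (a : DCode L M X → M) (x : X) :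
    Prop := h.code a x

variable {X Y Z W : Type}

/-- A definable predicate on an interpretable set. -/
def Dp [DSp L M X] (P : X → Prop) : Prop :=
  Defin L M {a : DCode L M X → M | ∃ x, dcode L a x ∧ P x}

instance : DSp L M M where
  Code := Fin 1
  finite := inferInstance
  code a x := a 0 = x
  exists_code x := ⟨fun _ => x, rfl⟩
  code_unique h h' := h.symm.trans h'
  definable_eq := by
    have := Set.Definable.preimage_comp (L := L) (A := (Set.univ : Set M)) (α := Fin 2)
      (β := Fin 1 ⊕ Fin 1) ![Sum.inl 0, Sum.inr 0] (Set.Definable.diagonal (L := L) Set.univ)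
    refine (congrArg (Defin L M) ?_).mp this
    ext c
    simp [Set.diagonal, eq_comm]

instance (k : ℕ) : DSp L M (Fin k → M) where
  Code := Fin k
  finite := inferInstance
  code a x := a = x
  exists_code x := ⟨x, rfl⟩
  code_unique h h' := h.symm.trans h'
  definable_eq := by
    have := Set.definable_iInter_of_finite (L := L) (A := (Set.univ : Set M)) fun i : Fin k =>
      Set.Definable.preimage_comp (α := Fin 2) (β := Fin k ⊕ Fin k) ![Sum.inl i, Sum.inr i]
        (Set.Definable.diagonal (L := L) Set.univ)
    refine (congrArg (Defin L M) ?_).mp this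
    ext c
    simp only [Set.mem_iInter, Set.mem_preimage, Set.diagonal, Set.mem_ofPred_eq]
    constructor
    · intro h
      exact ⟨_, rfl, funext fun i => by simpa [eq_comm] using h i⟩
    · rintro ⟨x, h, h'⟩ i
      have := congrFun (h.trans h'.symm) i
      simpa using this

variable {L M}

lemma code_iff [DSp L M X] {a : DCode L M X → M} {x : X} (h : dcode L a x) {P : X → Prop} :
    (∃ y, dcode L a y ∧ P y) ↔ P x :=
  ⟨fun ⟨_, h', hP⟩ => DSp.code_unique h' h ▸ hP, fun hP => ⟨x, h, hP⟩⟩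

lemma Dp.true [DSp L M X] : Dp L M fun _ : X => True := by
  have := Set.Definable.preimage_comp (α := DCode L M X ⊕ DCode L M X) (β := DCode L M X)
    (Sum.elim id id) (DSp.definable_eq (L := L) (M := M) (X := X))
  refine (congrArg (Defin L M) ?_).mp this
  ext a
  simp only [Set.mem_preimage, Set.mem_ofPred_eq, Function.comp_assoc, Sum.elim_comp_inl,
    Sum.elim_comp_inr, Function.comp_id, and_self, and_true]

instance [DSp L M X] [DSp L M Y] : DSp L M (X × Y) where
  Code := DCode L M X ⊕ DCode L M Y
  finite := inferInstance
  code c p := dcode L (c ∘ Sum.inl) p.1 ∧ dcode L (c ∘ Sum.inr) p.2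
  exists_code p := by
    obtain ⟨a, ha⟩ := DSp.exists_code (L := L) (M := M) p.1
    obtain ⟨b, hb⟩ := DSp.exists_code (L := L) (M := M) p.2
    exact ⟨Sum.elim a b, by simpa using ha, by simpa using hb⟩
  code_unique h h' := Prod.ext (DSp.code_unique h.1 h'.1) (DSp.code_unique h.2 h'.2)
  definable_eq := by
    have h₁ := Set.Definable.preimage_comp
      (Sum.elim (Sum.inl ∘ Sum.inl) (Sum.inr ∘ Sum.inl) :
        _ → (DCode L M X ⊕ DCode L M Y) ⊕ (DCode L M X ⊕ DCode L M Y))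
      (DSp.definable_eq (L := L) (M := M) (X := X))
    have h₂ := Set.Definable.preimage_comp
      (Sum.elim (Sum.inl ∘ Sum.inr) (Sum.inr ∘ Sum.inr) :
        _ → (DCode L M X ⊕ DCode L M Y) ⊕ (DCode L M X ⊕ DCode L M Y))
      (DSp.definable_eq (L := L) (M := M) (X := Y))
    refine (congrArg (Defin L M) ?_).mp (h₁.inter h₂)
    ext c
    simp only [Set.mem_preimage, Set.mem_ofPred_eq, Set.mem_inter_iff, Function.comp_assoc,
      Sum.elim_comp_inl, Sum.elim_comp_inr]
    constructor
    · rintro ⟨⟨x, h, h'⟩, y, k, k'⟩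
      exact ⟨(x, y), ⟨h, k⟩, h', k'⟩
    · rintro ⟨⟨x, y⟩, ⟨h, k⟩, h', k'⟩
      exact ⟨⟨x, h, h'⟩, y, k, k'⟩

section Connectives

variable [DSp L M X] [DSp L M Y] {P Q : X → Prop}

lemma Dp.and (hP : Dp L M P) (hQ : Dp L M Q) : Dp L M fun x => P x ∧ Q x := by
  refine (congrArg (Defin L M) ?_).mp (Set.Definable.inter hP hQ)
  ext a
  constructor
  · rintro ⟨⟨x, h, hx⟩, y, h', hy⟩
    obtain rfl := DSp.code_unique h h'
    exact ⟨x, h, hx, hy⟩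
  · rintro ⟨x, h, hx, hy⟩
    exact ⟨⟨x, h, hx⟩, x, h, hy⟩

lemma Dp.not (hP : Dp L M P) : Dp L M fun x => ¬ P x := by
  refine (congrArg (Defin L M) ?_).mp (Set.Definable.sdiff (Dp.true (L := L) (M := M) (X := X)) hP)
  ext a
  constructor
  · rintro ⟨⟨x, h, -⟩, hx⟩
    exact ⟨x, h, fun hP => hx ⟨x, h, hP⟩⟩
  · rintro ⟨x, h, hx⟩
    exact ⟨⟨x, h, trivial⟩, fun h' => hx ((code_iff h).1 h')⟩

lemma Dp.or (hP : Dp L M P) (hQ : Dp L M Q) : Dp L M fun x => P x ∨ Q x := by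
  simpa only [not_and_or, not_not] using (hP.not.and hQ.not).not

lemma Dp.imp (hP : Dp L M P) (hQ : Dp L M Q) : Dp L M fun x => P x → Q x := by
  simpa only [← imp_iff_not_or] using hP.not.or hQ

lemma Dp.const (p : Prop) : Dp L M fun _ : X => p := by
  by_cases h : p
  · simpa only [h] using Dp.true
  · simpa only [h, not_true] using (Dp.true (X := X)).not

lemma Dp.forall_of_finite {ι : Type} [Finite ι] {P : ι → X → Prop} (h : ∀ i, Dp L M (P i)) :
    Dp L M fun x => ∀ i, P i x := by
  refine (congrArg (Defin L M) ?_).mp (Set.Definable.inter (Dp.true (L := L) (M := M) (X := X))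
    (Set.definable_iInter_of_finite h))
  ext a
  constructor
  · rintro ⟨⟨x, h, -⟩, hx⟩
    exact ⟨x, h, fun i => (code_iff h).1 (Set.mem_iInter.1 hx i)⟩
  · rintro ⟨x, h, hx⟩
    exact ⟨⟨x, h, trivial⟩, Set.mem_iInter.2 fun i => ⟨x, h, hx i⟩⟩

lemma Dp.exists_of_finite {ι : Type} [Finite ι] {P : ι → X → Prop} (h : ∀ i, Dp L M (P i)) :
    Dp L M fun x => ∃ i, P i x := by
  simpa only [not_forall, not_not] using (Dp.forall_of_finite fun i => (h i).not).not

lemma Dp.ex {P : X → Y → Prop} (h : Dp L M fun p : X × Y => P p.1 p.2) :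
    Dp L M fun x => ∃ y, P x y := by
  refine (congrArg (Defin L M) ?_).mp (Set.Definable.image_comp h Sum.inl)
  ext a
  constructor
  · rintro ⟨c, ⟨⟨x, y⟩, h, hP⟩, rfl⟩
    exact ⟨x, h.1, y, hP⟩
  · rintro ⟨x, h, y, hP⟩
    obtain ⟨b, hb⟩ := DSp.exists_code (L := L) (M := M) y
    exact ⟨Sum.elim a b, ⟨(x, y), ⟨by simpa using h, by simpa using hb⟩, hP⟩,
      Sum.elim_comp_inl a b⟩

lemma Dp.all {P : X → Y → Prop} (h : Dp L M fun p : X × Y => P p.1 p.2) :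
    Dp L M fun x => ∀ y, P x y := by
  simpa only [not_exists, not_not] using (Dp.ex (P := fun x y => ¬ P x y) h.not).not

/-- Maps that act on codes by reindexing. -/
def IsReindex (L : FirstOrder.Language) (M : Type) [L.Structure M] [DSp L M X] [DSp L M Y]
    (r : X → Y) : Prop :=
  ∃ σ : DCode L M Y → DCode L M X, ∀ a x, dcode L a x → dcode L (a ∘ σ) (r x)

lemma Dp.reindex {P : Y → Prop} (hP : Dp L M P) {r : X → Y} (hr : IsReindex L M r) :
    Dp L M fun x => P (r x) := by
  obtain ⟨σ, hσ⟩ := hr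
  refine (congrArg (Defin L M) ?_).mp (Set.Definable.inter (Dp.true (L := L) (M := M) (X := X))
    (Set.Definable.preimage_comp σ hP))
  ext a
  constructor
  · rintro ⟨⟨x, h, -⟩, hx⟩
    exact ⟨x, h, (code_iff (hσ a x h)).1 hx⟩
  · rintro ⟨x, h, hx⟩
    exact ⟨⟨x, h, trivial⟩, _, hσ a x h, hx⟩

end Connectives

section Maps

variable [DSp L M X] [DSp L M Y] [DSp L M Z] [DSp L M W]

lemma IsReindex.id : IsReindex L M fun x : X => x := ⟨_root_.id, fun _ _ h => h⟩

lemma IsReindex.fst {f : X → Y × Z} (hf : IsReindex L M f) : IsReindex L M fun x => (f x).1 := by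
  obtain ⟨σ, hσ⟩ := hf
  exact ⟨σ ∘ Sum.inl, fun a x h => (hσ a x h).1⟩

lemma IsReindex.snd {f : X → Y × Z} (hf : IsReindex L M f) : IsReindex L M fun x => (f x).2 := by
  obtain ⟨σ, hσ⟩ := hf
  exact ⟨σ ∘ Sum.inr, fun a x h => (hσ a x h).2⟩

lemma IsReindex.prodMk {f : X → Y} {g : X → Z} (hf : IsReindex L M f) (hg : IsReindex L M g) :
    IsReindex L M fun x => (f x, g x) := by
  obtain ⟨σ, hσ⟩ := hf
  obtain ⟨τ, hτ⟩ := hg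
  exact ⟨Sum.elim σ τ, fun a x h => ⟨hσ a x h, hτ a x h⟩⟩

lemma IsReindex.apply {k : ℕ} {f : X → Fin k → M} (hf : IsReindex L M f) (i : Fin k) :
    IsReindex L M fun x => f x i := by
  obtain ⟨σ, hσ⟩ := hf
  exact ⟨fun _ => σ i, fun a x h => congrFun (hσ a x h) i⟩

lemma Dp.eq_prod : Dp L M fun p : X × X => p.1 = p.2 := by
  refine (congrArg (Defin L M) ?_).mp (DSp.definable_eq (L := L) (M := M) (X := X))
  ext c
  constructor
  · rintro ⟨x, h, h'⟩
    exact ⟨(x, x), ⟨h, h'⟩, rfl⟩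
  · rintro ⟨⟨x, y⟩, h, hxy⟩
    obtain rfl : x = y := hxy
    exact ⟨x, h⟩

variable (L M) in
/-- A definable map between interpretable sets. -/
@[fun_prop]
def DMap (f : X → Y) : Prop := Dp L M fun p : X × Y => f p.1 = p.2

lemma IsReindex.dmap {f : X → Y} (hf : IsReindex L M f) : DMap L M f := by
  obtain ⟨σ, hσ⟩ := hf
  exact Dp.eq_prod.reindex (r := fun p : X × Y => (f p.1, p.2))
    ⟨Sum.elim (Sum.inl ∘ σ) Sum.inr, fun a x h => ⟨hσ _ _ h.1, h.2⟩⟩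

lemma Dp.comp {P : Y → Prop} (hP : Dp L M P) {f : X → Y} (hf : DMap L M f) :
    Dp L M fun x => P (f x) := by
  have : Dp L M fun x => ∃ y, f x = y ∧ P y :=
    Dp.ex (Dp.and hf (hP.reindex (IsReindex.id.snd)))
  simpa using this

@[fun_prop]
lemma DMap.id : DMap L M fun x : X => x := IsReindex.id.dmap

@[fun_prop]
lemma DMap.const (y : Y) : DMap L M fun _ : X => y := by
  obtain ⟨b, hb⟩ := DSp.exists_code (L := L) (M := M) y
  have h : Dp L M fun z : Y => ∃ w : Y, w = y ∧ w = z := by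
    have h : Defin L M {c : DCode L M Y ⊕ DCode L M Y → M | c ∘ Sum.inl = b} := by
      refine (congrArg (Defin L M) ?_).mp (Set.definable_iInter_of_finite fun i : DCode L M Y =>
        Set.Definable.preimage_comp (β := DCode L M Y ⊕ DCode L M Y) (fun _ : Fin 1 => Sum.inl i)
          ((Set.Definable.singleton L (b i)).mono (Set.subset_univ _)))
      ext c
      simp only [Set.mem_iInter, Set.mem_preimage, Set.mem_ofPred_eq, funext_iff]
      simp
    have h' := Set.Definable.image_comp (h.inter (Dp.eq_prod (L := L) (M := M) (X := Y))) Sum.inr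
    refine (congrArg (Defin L M) ?_).mp h'
    ext a
    constructor
    · rintro ⟨c, ⟨h, ⟨⟨x, y'⟩, hxy, heq⟩⟩, rfl⟩
      obtain rfl : x = y' := heq
      have hx : dcode L (c ∘ Sum.inl) x := hxy.1
      rw [show c ∘ Sum.inl = b from h] at hx
      exact ⟨x, hxy.2, x, DSp.code_unique hx hb, rfl⟩
    · rintro ⟨z, h, w, rfl, rfl⟩
      exact ⟨Sum.elim b a, ⟨by simp, (w, w), ⟨by simpa using hb, by simpa using h⟩, rfl⟩, by simp⟩
  have := h.reindex (IsReindex.id (X := X × Y)).snd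
  unfold DMap
  simpa using this

@[fun_prop]
lemma DMap.comp {g : Y → Z} {f : X → Y} (hg : DMap L M g) (hf : DMap L M f) :
    DMap L M fun x => g (f x) := by
  have : Dp L M fun p : X × Z => ∃ y, f p.1 = y ∧ g y = p.2 :=
    Dp.ex <| Dp.and (Dp.reindex hf (IsReindex.id.fst.fst.prodMk IsReindex.id.snd))
      (Dp.reindex hg (IsReindex.id.snd.prodMk IsReindex.id.fst.snd))
  unfold DMap
  simpa using this

@[fun_prop]
lemma DMap.prodMk {f : X → Y} {g : X → Z} (hf : DMap L M f) (hg : DMap L M g) :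
    DMap L M fun x => (f x, g x) := by
  have : Dp L M fun p : X × Y × Z => f p.1 = p.2.1 ∧ g p.1 = p.2.2 :=
    Dp.and (Dp.reindex hf (IsReindex.id.fst.prodMk IsReindex.id.snd.fst))
      (Dp.reindex hg (IsReindex.id.fst.prodMk IsReindex.id.snd.snd))
  unfold DMap
  simpa only [Prod.ext_iff] using this

@[fun_prop]
lemma DMap.fst {f : X → Y × Z} (hf : DMap L M f) : DMap L M fun x => (f x).1 :=
  (IsReindex.id.fst.dmap).comp hf

@[fun_prop]
lemma DMap.snd {f : X → Y × Z} (hf : DMap L M f) : DMap L M fun x => (f x).2 :=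
  (IsReindex.id.snd.dmap).comp hf

@[fun_prop]
lemma DMap.apply {k : ℕ} (i : Fin k) : DMap L M fun f : Fin k → M => f i :=
  (IsReindex.id.apply i).dmap

lemma Dp.comp₂ {P : Y → Z → Prop} (hP : Dp L M fun p : Y × Z => P p.1 p.2) {f : X → Y} {g : X → Z}
    (hf : DMap L M f) (hg : DMap L M g) : Dp L M fun x => P (f x) (g x) :=
  hP.comp (hf.prodMk hg)

lemma Dp.eq {f g : X → Y} (hf : DMap L M f) (hg : DMap L M g) : Dp L M fun x => f x = g x :=
  Dp.eq_prod.comp₂ (P := fun x y => x = y) hf hg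

@[fun_prop]
lemma DMap.pi {k : ℕ} {f : X → Fin k → M} (hf : ∀ i, DMap L M fun x => f x i) : DMap L M f := by
  unfold DMap
  simp only [funext_iff]
  exact Dp.forall_of_finite fun i => .eq ((hf i).comp (by fun_prop)) (by fun_prop)

lemma Dp.comp₃ {P : X → Y → Z → Prop} (hP : Dp L M fun p : X × Y × Z => P p.1 p.2.1 p.2.2)
    {f : W → X} {g : W → Y} {h : W → Z} (hf : DMap L M f) (hg : DMap L M g) (hh : DMap L M h) :
    Dp L M fun x => P (f x) (g x) (h x) :=
  hP.comp (hf.prodMk (hg.prodMk hh))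

@[fun_prop]
lemma DMap.cons {m : ℕ} {f : X → M} {g : X → Fin m → M} (hf : DMap L M f) (hg : DMap L M g) :
    DMap L M fun x => (Fin.cons (f x) (g x) : Fin (m + 1) → M) := by
  refine .pi fun i => ?_
  refine Fin.cases ?_ (fun i => ?_) i
  · simpa using hf
  · simpa using (DMap.apply i).comp hg

end Maps

section Constructions

/-- A definable subset of an interpretable set. -/
@[reducible] def DSp.subtype [DSp L M X] {P : X → Prop} (hP : Dp L M P) : DSp L M {x // P x} where
  Code := DCode L M X
  finite := inferInstance
  code a x := dcode L a x.1
  exists_code x := DSp.exists_code x.1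
  code_unique h h' := Subtype.ext (DSp.code_unique h h')
  definable_eq := by
    refine (congrArg (Defin L M) ?_).mp (Dp.and Dp.eq_prod (hP.reindex IsReindex.id.fst))
    ext c
    constructor
    · rintro ⟨⟨x, y⟩, h, hxy, hx⟩
      obtain rfl : x = y := hxy
      exact ⟨⟨x, hx⟩, h⟩
    · rintro ⟨⟨x, hx⟩, h⟩
      exact ⟨(x, x), h, rfl, hx⟩

lemma DMap.subtype_val [DSp L M X] {P : X → Prop} (hP : Dp L M P) :
    let := DSp.subtype hP
    DMap L M (Subtype.val : {x // P x} → X) :=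
  let := DSp.subtype hP
  IsReindex.dmap ⟨_root_.id, fun _ _ h => h⟩

lemma DMap.of_subtype_val [DSp L M X] [DSp L M Y] {P : X → Prop} (hP : Dp L M P)
    {f : Y → {x // P x}} (hf : DMap L M fun y => (f y).1) :
    let := DSp.subtype hP
    DMap L M f := by
  let := DSp.subtype hP
  have h := DMap.subtype_val hP
  unfold DMap
  simp only [Subtype.ext_iff]
  exact Dp.eq (hf.comp (.fst .id)) (by fun_prop)

/-- The image of an interpretable set under a map with definable kernel. -/
@[reducible] def DSp.ofSurjective [DSp L M X] {π : X → Y} (hπ : Function.Surjective π)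
    (h : Dp L M fun p : X × X => π p.1 = π p.2) : DSp L M Y where
  Code := DCode L M X
  finite := inferInstance
  code a y := ∃ x, dcode L a x ∧ π x = y
  exists_code y := by
    obtain ⟨x, rfl⟩ := hπ y
    obtain ⟨a, ha⟩ := DSp.exists_code (L := L) (M := M) x
    exact ⟨a, x, ha, rfl⟩
  code_unique := by
    rintro a y z ⟨x, h, rfl⟩ ⟨x', h', rfl⟩
    rw [DSp.code_unique h h']
  definable_eq := by
    refine (congrArg (Defin L M) ?_).mp h
    ext c
    constructor
    · rintro ⟨⟨x, y⟩, h, hxy⟩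
      exact ⟨π x, ⟨x, h.1, rfl⟩, y, h.2, hxy.symm⟩
    · rintro ⟨y, ⟨x, h, rfl⟩, x', h', hx⟩
      exact ⟨(x, x'), ⟨h, h'⟩, hx.symm⟩

lemma DMap.ofSurjective [DSp L M X] {π : X → Y} (hπ : Function.Surjective π)
    (h : Dp L M fun p : X × X => π p.1 = π p.2) :
    let := DSp.ofSurjective hπ h
    DMap L M π :=
  let := DSp.ofSurjective hπ h
  IsReindex.dmap ⟨_root_.id, fun _ x h => ⟨x, h, rfl⟩⟩

end Constructions

end DefinableSpaces

section OMinimalBasics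

variable {L : FirstOrder.Language} {M : Type} [L.Structure M] [LinearOrder M]
  {X : Type} [DSp L M X]

/-- The reversed order. -/
abbrev dualOrder (M : Type) [LinearOrder M] : LinearOrder M := inferInstanceAs (LinearOrder Mᵒᵈ)

lemma Dp.lt (hM : OMinimal L M) {f g : X → M} (hf : DMap L M f) (hg : DMap L M g) :
    Dp L M fun x => f x < g x := by
  have h : Dp L M fun a : Fin 2 → M => a 0 < a 1 := by
    refine (congrArg (Defin L M) ?_).mp hM.2.2.2.2.1
    ext a
    exact ⟨fun h => ⟨a, rfl, h⟩, fun ⟨_, h, h'⟩ => h ▸ h'⟩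
  refine h.comp (f := fun x => ![f x, g x]) (DMap.pi fun i => ?_)
  fin_cases i <;> assumption

lemma Dp.le (hM : OMinimal L M) {f g : X → M} (hf : DMap L M f) (hg : DMap L M g) :
    Dp L M fun x => f x ≤ g x := by
  simpa only [not_lt] using (Dp.lt hM hg hf).not

lemma OMinimal.dual (hM : OMinimal L M) : @OMinimal L M _ (dualOrder M) := by
  have hlt := Dp.lt hM (DMap.apply (L := L) (M := M) (k := 2) 1) (DMap.apply 0)
  obtain ⟨h₁, h₂, h₃, h₄, -, h⟩ := hM
  refine ⟨inferInstanceAs (DenselyOrdered Mᵒᵈ), inferInstanceAs (NoMinOrder Mᵒᵈ),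
    inferInstanceAs (NoMaxOrder Mᵒᵈ), h₄, ?_, ?_⟩
  · refine (congrArg (Defin L M) ?_).mp hlt
    ext a
    exact ⟨fun ⟨_, h, h'⟩ => by obtain rfl := h; exact h', fun h => ⟨a, rfl, h⟩⟩
  · intro s hs
    obtain ⟨n, t, ht, rfl⟩ := h s hs
    refine ⟨n, t, fun i => ?_, rfl⟩
    rcases ht i with ⟨a, h⟩ | ⟨a, b, h⟩ | ⟨a, h⟩ | ⟨a, h⟩ | h <;> rw [h]
    · exact .inl ⟨a, rfl⟩
    · refine .inr (.inl ⟨b, a, ?_⟩)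
      ext x
      exact and_comm
    · exact .inr (.inr (.inr (.inl ⟨a, rfl⟩)))
    · exact .inr (.inr (.inl ⟨a, rfl⟩))
    · exact .inr (.inr (.inr (.inr rfl)))

/-- Membership in a definable subset of the line can only change at finitely many points. -/
lemma OMinimal.exists_finset (hM : OMinimal L M) {s : M → Prop} (hs : Dp L M s) :
    ∃ Z : Finset M, ∀ x y, x < y → (∀ z ∈ Z, x ≤ z → ¬ z ≤ y) → (s x ↔ s y) := by
  have hs' : Defin L M {x : Fin 1 → M | x 0 ∈ {x | s x}} := by
    refine (congrArg (Defin L M) ?_).mp hs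
    ext a
    exact ⟨fun ⟨_, h, h'⟩ => by obtain rfl := h; exact h', fun h => ⟨a (0 : Fin 1), rfl, h⟩⟩
  obtain ⟨n, t, ht, hst⟩ := hM.2.2.2.2.2 _ hs'
  have key : ∀ i, ∃ Z : Finset M, ∀ x y, x < y → (∀ z ∈ Z, x ≤ z → ¬ z ≤ y) →
      (x ∈ t i ↔ y ∈ t i) := by
    intro i
    rcases ht i with ⟨a, h⟩ | ⟨a, b, h⟩ | ⟨a, h⟩ | ⟨a, h⟩ | h <;> rw [h]
    · refine ⟨{a}, fun x y hxy hZ => ?_⟩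
      have := hZ a (by simp)
      simp only [Set.mem_singleton_iff]
      grind
    · refine ⟨{a, b}, fun x y hxy hZ => ?_⟩
      have := hZ a (by simp)
      have := hZ b (by simp)
      simp only [Set.mem_Ioo]
      grind
    · refine ⟨{a}, fun x y hxy hZ => ?_⟩
      have := hZ a (by simp)
      simp only [Set.mem_Ioi]
      grind
    · refine ⟨{a}, fun x y hxy hZ => ?_⟩
      have := hZ a (by simp)
      simp only [Set.mem_Iio]
      grind
    · exact ⟨∅, by simp⟩
  choose Z hZ using key
  refine ⟨Finset.univ.biUnion Z, fun x y hxy h => ?_⟩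
  have : ∀ w, s w ↔ ∃ i, w ∈ t i := fun w => by
    rw [← Set.mem_iUnion, ← hst]
    rfl
  rw [this, this]
  exact exists_congr fun i => hZ i x y hxy fun z hz => h z (Finset.mem_biUnion.2 ⟨i, by simp, hz⟩)

lemma exists_gt_le_of_finite [NoMaxOrder M] {F : Set M} (hF : F.Finite) (t : M) :
    ∃ u > t, ∀ z ∈ F, t < z → u ≤ z := by
  induction F, hF using Set.Finite.induction_on with
  | empty => simpa using exists_gt t
  | @insert a s _ _ ih =>
    obtain ⟨u, hu, h⟩ := ih
    by_cases ha : t < a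
    · refine ⟨min u a, lt_min hu ha, ?_⟩
      rintro z (rfl | hz) hz'
      · exact min_le_right _ _
      · exact (min_le_left _ _).trans (h z hz hz')
    · refine ⟨u, hu, ?_⟩
      rintro z (rfl | hz) hz'
      · exact absurd hz' ha
      · exact h z hz hz'

lemma OMinimal.right_germ (hM : OMinimal L M) {s : M → Prop} (hs : Dp L M s) (t : M) :
    (∃ u > t, ∀ z, t < z → z < u → s z) ∨ ∃ u > t, ∀ z, t < z → z < u → ¬ s z := by
  obtain ⟨Z, hZ⟩ := hM.exists_finset hs
  have := hM.2.2.1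
  obtain ⟨u, hu, h⟩ := exists_gt_le_of_finite Z.finite_toSet t
  have key : ∀ x y, t < x → x < y → y < u → (s x ↔ s y) := fun x y hx hxy hy =>
    hZ x y hxy fun z hz hxz hzy => absurd (h z hz (hx.trans_le hxz)) (not_le.2 (hzy.trans_lt hy))
  by_cases h' : ∃ z, t < z ∧ z < u ∧ s z
  · obtain ⟨z, hz, hzu, hsz⟩ := h'
    exact .inl ⟨z, hz, fun y hy hyz => (key y z hy hyz hzu).2 hsz⟩
  · push Not at h'
    exact .inr ⟨u, hu, h'⟩

lemma OMinimal.exists_interval (hM : OMinimal L M) {s : M → Prop} (hs : Dp L M s)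
    (hinf : {x | s x}.Infinite) : ∃ u w, u < w ∧ ∀ z, u < z → z < w → s z := by
  classical
  obtain ⟨Z, hZ⟩ := hM.exists_finset hs
  have h' := hinf.sdiff Z.finite_toSet
  obtain ⟨x, hx, y, hy, hne, hxy⟩ := h'.exists_ne_map_eq_of_mapsTo
    (f := fun x => Z.filter (· < x)) (t := (Z.powerset : Set (Finset M)))
    (fun x _ => Finset.mem_coe.2 (Finset.mem_powerset.2 (Finset.filter_subset _ _)))
    (Finset.finite_toSet _)
  wlog hlt : x < y generalizing x y
  · exact this y hy x hx hne.symm hxy.symm (lt_of_le_of_ne (not_lt.1 hlt) hne.symm)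
  refine ⟨x, y, hlt, fun z hxz hzy => (hZ x z hxz fun w hw hxw hwz => ?_).1 hx.1⟩
  have h₁ : w ∈ Z.filter (· < y) := by simp [hw, hwz.trans_lt hzy]
  have h₂ : w ∈ Z.filter (· < x) := hxy ▸ h₁
  exact absurd hxw (not_le.2 (Finset.mem_filter.1 h₂).2)

lemma OMinimal.exists_isLUB (hM : OMinimal L M) {s : M → Prop} (hs : Dp L M s)
    (hne : ∃ x, s x) (hbdd : ∃ u, ∀ x, s x → x ≤ u) : ∃ c, IsLUB {x | s x} c := by
  by_cases hmax : ∃ c, s c ∧ ∀ x, s x → x ≤ c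
  · obtain ⟨c, hc, h⟩ := hmax
    exact ⟨c, h, fun u hu => hu hc⟩
  push Not at hmax
  by_contra! hcon
  have hU : Dp L M fun u => ∀ x, s x → x ≤ u :=
    .all (.imp (hs.comp (by fun_prop)) (.le hM (by fun_prop) (by fun_prop)))
  obtain ⟨Z, hZ⟩ := hM.exists_finset hU
  obtain ⟨x, hx⟩ := hne
  obtain ⟨u, hu⟩ := hbdd
  have hfin : ((Z : Set M) ∪ {x, u}).Finite := by simp
  have h₁ := (hfin.subset (Set.inter_subset_left (t := {r | ∀ x, s x → x ≤ r}))).exists_minimal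
    ⟨u, by simp, hu⟩
  have h₂ := (hfin.subset (Set.inter_subset_left (t := {r | ¬ ∀ x, s x → x ≤ r}))).exists_maximal
    ⟨x, by simp, fun h => by obtain ⟨y, hy, hxy⟩ := hmax x hx; exact absurd (h y hy) (not_le.2 hxy)⟩
  obtain ⟨z₂, ⟨hz₂, hz₂U⟩, hmin⟩ := h₁
  obtain ⟨z₁, ⟨hz₁, hz₁U⟩, hmaxi⟩ := h₂
  have hnl := hcon z₂
  obtain ⟨u', hu', hlt⟩ : ∃ u', (∀ x, s x → x ≤ u') ∧ u' < z₂ := by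
    by_contra! h
    exact hnl ⟨hz₂U, fun r hr => h r hr⟩
  simp only [Set.mem_ofPred_eq, not_forall, not_le, exists_prop] at hz₁U
  obtain ⟨y, hy, hlty⟩ := hz₁U
  have hyU : ¬ ∀ x, s x → x ≤ y := fun h => by
    obtain ⟨w, hw, hyw⟩ := hmax y hy
    exact absurd (h w hw) (not_le.2 hyw)
  have hyu : y < u' := lt_of_le_of_ne (hu' y hy) (by rintro rfl; exact hyU hu')
  refine hyU ((hZ y u' hyu fun z hz hyz hzu => ?_).2 hu')
  by_cases hzU : ∀ x, s x → x ≤ z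
  · have := hmin ⟨Or.inl hz, hzU⟩ (hzu.trans hlt.le)
    exact absurd (this.trans hzu) (not_le.2 hlt)
  · have := hmaxi ⟨Or.inl hz, hzU⟩ (hlty.le.trans hyz)
    exact absurd (hyz.trans this) (not_le.2 hlty)

lemma OMinimal.exists_isGLB (hM : OMinimal L M) {s : M → Prop} (hs : Dp L M s)
    (hne : ∃ x, s x) (hbdd : ∃ u, ∀ x, s x → u ≤ x) : ∃ c, IsGLB {x | s x} c :=
  @OMinimal.exists_isLUB L M _ (dualOrder M) hM.dual s hs hne hbdd

/-- A definable predicate that is locally constant on a closed interval is constant there. -/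
lemma OMinimal.imp_of_locally_const (hM : OMinimal L M) {s : M → Prop} (hs : Dp L M s) {x y : M}
    (hxy : x ≤ y) (hr : ∀ t, x ≤ t → t < y → ∃ u > t, ∀ z, t < z → z < u → (s z ↔ s t))
    (hl : ∀ t, x < t → t ≤ y → ∃ u < t, ∀ z, u < z → z < t → (s z ↔ s t)) (hx : s x) : s y := by
  have := hM.1
  obtain ⟨c, hc⟩ := hM.exists_isLUB (s := fun t => x ≤ t ∧ t ≤ y ∧ ∀ r, x ≤ r → r ≤ t → s r)
    (.and (.le hM (by fun_prop) (by fun_prop)) (.and (.le hM (by fun_prop) (by fun_prop))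
      (.all (.imp (.le hM (by fun_prop) (by fun_prop)) (.imp (.le hM (by fun_prop) (by fun_prop))
        (hs.comp (by fun_prop)))))))
    ⟨x, le_rfl, hxy, fun r h h' => le_antisymm h h' ▸ hx⟩ ⟨y, fun t ht => ht.2.1⟩
  have hxc : x ≤ c := hc.1 ⟨le_rfl, hxy, fun r h h' => le_antisymm h h' ▸ hx⟩
  have hcy : c ≤ y := hc.2 fun t ht => ht.2.1
  have hlt : ∀ r, x ≤ r → r < c → s r := fun r hxr hrc => by
    obtain ⟨t, ht, hrt⟩ := (lt_isLUB_iff hc).1 hrc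
    exact ht.2.2 r hxr hrt.le
  have hsc : s c := by
    rcases hxc.eq_or_lt with rfl | hxc
    · exact hx
    obtain ⟨u, hu, h⟩ := hl c hxc hcy
    obtain ⟨z, hz, hzc⟩ := exists_between (max_lt hu hxc)
    exact (h z ((le_max_left _ _).trans_lt hz) hzc).1 (hlt z ((le_max_right _ _).trans hz.le) hzc)
  rcases hcy.eq_or_lt with rfl | hcy
  · exact hsc
  obtain ⟨u, hu, h⟩ := hr c hxc hcy
  obtain ⟨z, hz, hzc⟩ := exists_between (lt_min hu hcy)
  suffices h' : ∀ r, x ≤ r → r ≤ z → s r from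
    absurd (hc.1 ⟨hxc.trans hz.le, hzc.le.trans (min_le_right _ _), h'⟩) (not_le.2 hz)
  intro r hxr hrz
  rcases lt_trichotomy r c with hrc | rfl | hrc
  · exact hlt r hxr hrc
  · exact hsc
  · exact (h r hrc (hrz.trans_lt (hzc.trans_le (min_le_left _ _)))).2 hsc

end OMinimalBasics

section BoxLemma

variable {L : FirstOrder.Language} {M : Type} [L.Structure M] [LinearOrder M]
  {X : Type} [DSp L M X]

lemma OMinimal.finite_of_locally_finite (hM : OMinimal L M) {R : M → M → Prop}
    (hR : Dp L M fun p : M × M => R p.1 p.2) (hlt : ∀ t w, R t w → t < w)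
    (hdown : ∀ t w w', R t w → t < w' → w' ≤ w → R t w')
    (hfin : ∀ u w, u < w → {t | t ≤ u ∧ R t w}.Finite) : {t | ∃ w, R t w}.Finite := by
  have := hM.1
  by_contra hinf
  obtain ⟨a, b, hab, h⟩ := hM.exists_interval (.ex hR) hinf
  have hB : Dp L M fun x => (a < x ∧ x < b) ∧ ∃ w, R x w ∧ ∀ y, a < y → y < x → ¬ R y w := by
    refine .and (.and (.lt hM ?_ ?_) (.lt hM ?_ ?_)) (.ex (.and hR (.all (.imp (.lt hM ?_ ?_)
      (.imp (.lt hM ?_ ?_) (.not (hR.comp₂ ?_ ?_))))))) <;> fun_prop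
  have hmem : ∀ c, a < c → c < b → ∃ x, (a < x ∧ x ≤ c) ∧
      ((a < x ∧ x < b) ∧ ∃ w, R x w ∧ ∀ y, a < y → y < x → ¬ R y w) := by
    intro c hac hcb
    obtain ⟨w, hw⟩ := h c hac hcb
    obtain ⟨y, ⟨⟨hyc, hyw⟩, hay⟩, hmin⟩ := ((hfin c w (hlt _ _ hw)).subset
      (Set.inter_subset_left (t := Set.Ioi a))).exists_minimal ⟨c, ⟨le_rfl, hw⟩, hac⟩
    refine ⟨y, ⟨hay, hyc⟩, ⟨hay, hyc.trans_lt hcb⟩, w, hyw, fun z haz hzy hzw => ?_⟩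
    exact absurd (hmin (y := z) ⟨⟨hzy.le.trans hyc, hzw⟩, haz⟩ hzy.le) (not_le.2 hzy)
  obtain ⟨v, hv, hvB⟩ | ⟨v, hv, hvB⟩ := hM.right_germ hB a
  · obtain ⟨t, hat, htv⟩ := exists_between hv
    obtain ⟨w, hw⟩ := (hvB t hat htv).2
    obtain ⟨u, htu, hu⟩ := exists_between (lt_min (hlt _ _ hw.1) htv)
    have huw := hu.trans_le (min_le_left _ _)
    refine Set.Ioo_infinite htu ((hfin u w huw).subset fun s hs => ⟨hs.2.le, ?_⟩)
    obtain ⟨w', hs', hw'⟩ :=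
      (hvB s (hat.trans hs.1) (hs.2.trans (hu.trans_le (min_le_right _ _)))).2
    rcases le_or_gt w' w with hle | hgt
    · exact absurd (hdown t w w' hw.1 (hs.1.trans (hlt _ _ hs')) hle) (hw' t hat hs.1)
    · exact hdown s w' w hs' (hs.2.trans huw) hgt.le
  · obtain ⟨c, hac, hc⟩ := exists_between (lt_min hv hab)
    obtain ⟨x, hx, hxB⟩ := hmem c hac (hc.trans_le (min_le_right _ _))
    exact hvB x hx.1 (hx.2.trans_lt (hc.trans_le (min_le_left _ _))) hxB

/-- If no open interval is contained in infinitely many fibres, then only finitely many fibres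
contain an initial open interval of the complement of a cut `U`. -/
lemma OMinimal.finite_of_cut (hM : OMinimal L M) {D : X → M → Prop}
    (hD : Dp L M fun p : X × M => D p.1 p.2) {U : M → Prop} (hU : Dp L M U)
    (hlow : ∀ x y, ¬ U x → x ≤ y → ¬ U y) (hcut : ∀ w, ¬ U w → ∃ u < w, ∀ z, u < z → ¬ U z)
    (hfin : ∀ u w, u < w → {x | ∀ z, u < z → z < w → D x z}.Finite) :
    {x | ∃ w, ¬ U w ∧ ∀ z, ¬ U z → z < w → D x z}.Finite := by
  have := hM.1
  set E : M → Set X := fun w => {x | ∀ z, ¬ U z → z < w → D x z} with hE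
  have hEfin : ∀ w, ¬ U w → (E w).Finite := fun w hw => by
    obtain ⟨u, huw, hu⟩ := hcut w hw
    exact (hfin u w huw).subset fun x hx z huz hzw => hx z (hu z huz) hzw
  have hEanti : ∀ w w', w ≤ w' → E w' ⊆ E w := fun w w' h x hx z hz hzw =>
    hx z hz (hzw.trans_le h)
  have hEdef : Dp L M fun p : X × M => p.1 ∈ E p.2 := by
    refine .all (.imp (.not (hU.comp ?_)) (.imp (.lt hM ?_ ?_) (hD.comp₂ ?_ ?_))) <;> fun_prop
  have hV : {w | ¬ U w ∧ ∃ x, x ∈ E w ∧ ∀ w', w < w' → x ∉ E w'}.Finite := by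
    by_contra hinf
    obtain ⟨p, q, hpq, h⟩ := hM.exists_interval (s := fun w => ¬ U w ∧ ∃ x, x ∈ E w ∧
      ∀ w', w < w' → x ∉ E w') (by
        refine .and hU.not (.ex (.and (hEdef.comp₂ (P := fun x w => x ∈ E w) ?_ ?_) (.all (.imp
          (.lt hM ?_ ?_) (.not (hEdef.comp₂ (P := fun x w => x ∈ E w) ?_ ?_)))))) <;> fun_prop) hinf
    obtain ⟨p', hpp', hp'q⟩ := exists_between hpq
    have h' : ∀ w ∈ Set.Ioo p' q, ∃ x, x ∈ E w ∧ ∀ w', w < w' → x ∉ E w' := fun w hw =>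
      (h w (hpp'.trans hw.1) hw.2).2
    have : Nonempty X := ⟨(h p' hpp' hp'q).2.choose⟩
    choose! f hf hf' using h'
    refine Set.infinite_of_injOn_mapsTo (f := f) (t := E p') (fun w hw w' hw' heq => ?_)
      (fun w hw => hEanti _ _ hw.1.le (hf w hw)) (Set.Ioo_infinite hp'q)
        (hEfin p' (h p' hpp' hp'q).1)
    by_contra hne
    rcases lt_or_gt_of_ne hne with hlt | hlt
    · exact hf' w hw w' hlt (heq ▸ hf w' hw')
    · exact hf' w' hw' w hlt (heq ▸ hf w hw)
  by_contra hX
  obtain ⟨x₁, w₁, hw₁, -⟩ := Set.Infinite.nonempty hX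
  obtain ⟨w₀, hw₀, hmin⟩ : ∃ w₀, ¬ U w₀ ∧ ∀ w, (¬ U w ∧ ∃ x, x ∈ E w ∧ ∀ w', w < w' → x ∉ E w') →
      w₀ ≤ w := by
    obtain ⟨w₀, hmem, hmin⟩ := Set.exists_min_image _ _root_.id (hV.insert w₁)
      (Set.insert_nonempty _ _)
    refine ⟨w₀, ?_, fun w hw => hmin w (.inr hw)⟩
    rcases hmem with rfl | h
    · exact hw₁
    · exact h.1
  refine hX ((hEfin w₀ hw₀).subset ?_)
  rintro x ⟨w, hw, hx⟩
  by_contra hx₀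
  have hbd : ∀ w', ¬ U w' ∧ x ∈ E w' → w' ≤ w₀ := fun w' h => by
    by_contra! hlt
    exact hx₀ (hEanti _ _ hlt.le h.2)
  obtain ⟨c, hc⟩ := hM.exists_isLUB (s := fun w => ¬ U w ∧ x ∈ E w) (by
    refine .and hU.not (hEdef.comp₂ (P := fun x w => x ∈ E w) ?_ ?_) <;> fun_prop) ⟨w, hw, hx⟩
    ⟨w₀, hbd⟩
  have hUc := hlow w c hw (hc.1 ⟨hw, hx⟩)
  have hxc : x ∈ E c := fun z hz hzc => by
    obtain ⟨w', hw', hzw'⟩ := (lt_isLUB_iff hc).1 hzc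
    exact hw'.2 z hz hzw'
  exact hx₀ (hEanti _ _ (hmin c ⟨hUc, x, hxc, fun w' hcw' hw' =>
    absurd (hc.1 ⟨hlow c w' hUc hcw'.le, hw'⟩) (not_le.2 hcw')⟩) hxc)

/-- If infinitely many fibres of a definable family of subsets of the line are infinite, then
infinitely many fibres contain a common open interval. -/
theorem OMinimal.exists_common_interval (hM : OMinimal L M) {D : X → M → Prop}
    (hD : Dp L M fun p : X × M => D p.1 p.2) (hinf : {x | {z | D x z}.Infinite}.Infinite) :
    ∃ u w, u < w ∧ {x | ∀ z, u < z → z < w → D x z}.Infinite := by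
  have := hM.1
  have := hM.2.1
  by_contra! hfin
  set R : M → M → Prop := fun t w => t < w ∧ ∃ x, (∀ z, t < z → z < w → D x z) ∧
    ∀ r, r < t → ¬ ∀ z, r < z → z < w → D x z with hR
  have hDI : Dp L M fun p : X × M × M => ∀ z, p.2.1 < z → z < p.2.2 → D p.1 z := by
    refine .all (.imp (.lt hM ?_ ?_) (.imp (.lt hM ?_ ?_) (hD.comp₂ ?_ ?_))) <;> fun_prop
  have hRdef : Dp L M fun p : M × M => R p.1 p.2 := by
    refine .and (.lt hM ?_ ?_) (.ex (.and (hDI.comp₃ (P := fun x t w => ∀ z, t < z → z < w → D x z)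
      ?_ ?_ ?_) (.all (.imp (.lt hM ?_ ?_) (.not (hDI.comp₃
      (P := fun x t w => ∀ z, t < z → z < w → D x z) ?_ ?_ ?_)))))) <;> fun_prop
  have hT : {t | ∃ w, R t w}.Finite := by
    refine hM.finite_of_locally_finite hRdef (fun t w h => h.1) ?_ ?_
    · rintro t w w' ⟨htw, x, hx, hx'⟩ htw' hw'
      refine ⟨htw', x, fun z hz hzw => hx z hz (hzw.trans_le hw'), fun r hr h => hx' r hr ?_⟩
      intro z hrz hzw
      rcases lt_or_ge z w' with h' | h'
      · exact h z hrz h'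
      · exact hx z (htw'.trans_le h') hzw
    · intro u w huw
      by_contra hinf
      replace hinf : Set.Infinite _ := hinf
      have h' : ∀ t ∈ {t | t ≤ u ∧ R t w}, ∃ x, (∀ z, t < z → z < w → D x z) ∧
        ∀ r, r < t → ¬ ∀ z, r < z → z < w → D x z := fun t ht => ht.2.2
      have : Nonempty X := ⟨hinf.nonempty.some_mem.2.2.choose⟩
      choose! f hf hf' using h'
      refine Set.infinite_of_injOn_mapsTo (f := f) (t := {x | ∀ z, u < z → z < w → D x z})
        (fun t ht t' ht' heq => ?_) (fun t ht z huz hzw => hf t ht z (ht.1.trans_lt huz) hzw) hinf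
        (hfin u w huw)
      by_contra hne
      rcases lt_or_gt_of_ne hne with hlt | hlt
      · exact hf' t' ht' t hlt (heq ▸ hf t ht)
      · exact hf' t ht t' hlt (heq ▸ hf t' ht')
  have hbot : {x | ∃ w, ∀ z, z < w → D x z}.Finite := by
    have := hM.finite_of_cut hD (U := fun _ => False) (Dp.const _) (fun _ _ h _ => h)
      (fun w _ => by simpa using exists_lt w) hfin
    simpa using this
  have htop : ∀ t, {x | ∃ w, t < w ∧ ∀ z, t < z → z < w → D x z}.Finite := fun t => by
    have := hM.finite_of_cut hD (U := fun z => z ≤ t) (.le hM (by fun_prop) (by fun_prop))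
      (fun x y h h' h'' => h (h'.trans h'')) (fun w hw => ⟨t, not_le.1 hw, fun z hz => not_le.2 hz⟩)
      hfin
    simpa using this
  refine hinf ((hbot.union (hT.biUnion fun t _ => htop t)).subset ?_)
  intro x hx
  obtain ⟨u, w, huw, h⟩ := hM.exists_interval (s := D x) (hD.comp₂ (by fun_prop) (by fun_prop)) hx
  by_cases hall : ∀ r, r < w → ∀ z, r < z → z < w → D x z
  · refine .inl ⟨w, fun z hz => ?_⟩
    obtain ⟨r, hr⟩ := exists_lt z
    exact hall r (hr.trans hz) z hr hz
  push Not at hall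
  obtain ⟨r₀, hr₀, z₀, hz₀, hz₀w, hz₀D⟩ := hall
  obtain ⟨t, ht⟩ := hM.exists_isGLB (s := fun r => ∀ z, r < z → z < w → D x z)
    (hDI.comp₃ (P := fun x t w => ∀ z, t < z → z < w → D x z) (by fun_prop) (by fun_prop)
      (by fun_prop)) ⟨u, h⟩ ⟨r₀, fun r hr => by
      by_contra! hlt
      exact hz₀D (hr z₀ (hlt.trans hz₀) hz₀w)⟩
  have htu : t ≤ u := ht.1 h
  have htD : ∀ z, t < z → z < w → D x z := fun z htz hzw => by
    obtain ⟨r, hr, hrz⟩ := (isGLB_lt_iff ht).1 htz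
    exact hr z hrz hzw
  refine .inr (Set.mem_biUnion (x := t) ⟨w, htu.trans_lt huw, x, htD, fun r hr h' => ?_⟩
    ⟨w, htu.trans_lt huw, htD⟩)
  exact absurd (ht.1 h') (not_le.2 hr)

end BoxLemma

section UniformBoxes

variable {L : FirstOrder.Language} {M : Type} [L.Structure M] [LinearOrder M]
  {X Y : Type} [DSp L M X] [DSp L M Y] {k : ℕ}

/-- A definable planar set with infinitely many infinite fibres contains an open box. -/
lemma OMinimal.exists_planar_box (hM : OMinimal L M) {D : M → M → Prop}
    (hD : Dp L M fun p : M × M => D p.1 p.2) (hinf : {x | {z | D x z}.Infinite}.Infinite) :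
    ∃ p q u w, p < q ∧ u < w ∧ ∀ t z, p < t → t < q → u < z → z < w → D t z := by
  obtain ⟨u, w, huw, h⟩ := hM.exists_common_interval hD hinf
  obtain ⟨p, q, hpq, h'⟩ := hM.exists_interval (by
    refine .all (.imp (.lt hM ?_ ?_) (.imp (.lt hM ?_ ?_) (hD.comp₂ ?_ ?_))) <;> fun_prop) h
  exact ⟨p, q, u, w, hpq, huw, fun t z hp hq => h' t hp hq z⟩

lemma OMinimal.infinite_of_exists_gt (hM : OMinimal L M) {s : M → Prop} {a b : M} (hab : a < b)
    (h : ∀ z, a < z → z < b → s z) : {z | s z}.Infinite := by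
  have := hM.1
  exact (Set.Ioo_infinite hab).mono fun z hz => h z hz.1 hz.2

/-- If each of infinitely many fibres of a definable family contains an open box, then some point
lies in infinitely many fibres. -/
theorem OMinimal.exists_common_point (hM : OMinimal L M) {m : ℕ} {F : X → Prop} (hF : Dp L M F)
    {D : X → (Fin m → M) → Prop} (hD : Dp L M fun p : X × (Fin m → M) => D p.1 p.2)
    (hinf : {x | F x}.Infinite)
    (hbox : ∀ x, F x → ∃ a b : Fin m → M, (∀ i, a i < b i) ∧
      ∀ z, (∀ i, a i < z i ∧ z i < b i) → D x z) :
    ∃ z, {x | F x ∧ D x z}.Infinite := by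
  have := hM.1
  induction m generalizing F with
  | zero =>
    refine ⟨Fin.elim0, hinf.mono fun x hx => ⟨hx, ?_⟩⟩
    obtain ⟨a, b, -, h⟩ := hbox x hx
    exact h _ fun i => i.elim0
  | succ m ih =>
    set B : X → M → Prop := fun x t => ∃ a b : Fin m → M, (∀ i, a i < b i) ∧
      ∀ z : Fin m → M, (∀ i, a i < z i ∧ z i < b i) → D x (Fin.cons t z)
    have hB : Dp L M fun p : X × M => B p.1 p.2 := by
      refine .ex (.ex (.and (.forall_of_finite fun i => .lt hM ?_ ?_) (.all (.imp
        (.forall_of_finite fun i => .and (.lt hM ?_ ?_) (.lt hM ?_ ?_)) (hD.comp₂ ?_ ?_)))))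
        <;> fun_prop
    have hFB : Dp L M fun p : X × M => F p.1 ∧ B p.1 p.2 := .and (hF.comp (.fst .id)) hB
    obtain ⟨u, w, huw, h⟩ :=
      hM.exists_common_interval (D := fun x t => F x ∧ B x t) hFB (hinf.mono fun x hx => by
      obtain ⟨a, b, hab, h⟩ := hbox x hx
      refine hM.infinite_of_exists_gt (hab 0) fun t hat htb =>
        ⟨hx, fun i => a i.succ, fun i => b i.succ, fun i => hab _, fun z hz => h _ fun i => ?_⟩
      refine Fin.cases ⟨?_, ?_⟩ (fun i => ?_) i
      · simpa using hat
      · simpa using htb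
      · simpa using hz i)
    obtain ⟨t, hut, htw⟩ := exists_between huw
    have h' : {x | F x ∧ B x t}.Infinite :=
      Set.Infinite.mono (s := {x | ∀ z, u < z → z < w → F x ∧ B x z}) (fun x hx => hx t hut htw) h
    obtain ⟨z, hz⟩ := ih (F := fun x => F x ∧ B x t) (D := fun x z => D x (Fin.cons t z))
      (hFB.comp₂ (P := fun x t => F x ∧ B x t) .id (by fun_prop))
      (hD.comp₂ (by fun_prop) (by fun_prop)) h' fun x hx => hx.2
    exact ⟨_, hz.mono fun _ hx => ⟨hx.1.1, hx.2⟩⟩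

/-- The point `y` lies in the open box with corners `u` and `w`. -/
def InBox (u w y : Fin k → M) : Prop := ∀ i, u i < y i ∧ y i < w i

lemma Dp.inBox (hM : OMinimal L M) {u w y : X → Fin k → M} (hu : DMap L M u) (hw : DMap L M w)
    (hy : DMap L M y) : Dp L M fun x => InBox (u x) (w x) (y x) := by
  refine .forall_of_finite fun i => .and (.lt hM ?_ ?_) (.lt hM ?_ ?_) <;> fun_prop

/-- If each point of an infinite definable set has a box around it with a property inherited by
smaller boxes, then a single box works for infinitely many points. -/
theorem OMinimal.exists_common_box (hM : OMinimal L M) {F : X → Prop} (hF : Dp L M F)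
    {v : X → Fin k → M} (hv : DMap L M v) {Q : X → (Fin k → M) → (Fin k → M) → Prop}
    (hQ : Dp L M fun p : X × (Fin k → M) × (Fin k → M) => Q p.1 p.2.1 p.2.2)
    (hmono : ∀ x u w u' w', Q x u w → InBox u' w' (v x) → (∀ i, u i ≤ u' i) → (∀ i, w' i ≤ w i) →
      Q x u' w')
    (hinf : {x | F x}.Infinite) (hbox : ∀ x, F x → ∃ u w, InBox u w (v x) ∧ Q x u w) :
    ∃ u w, {x | F x ∧ InBox u w (v x) ∧ Q x u w}.Infinite := by
  have hlo : DMap L M fun z : Fin (k + k) → M => fun i => z (Fin.castAdd k i) :=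
    DMap.pi fun i => by fun_prop
  have hhi : DMap L M fun z : Fin (k + k) → M => fun i => z (Fin.natAdd k i) :=
    DMap.pi fun i => by fun_prop
  obtain ⟨z, hz⟩ := hM.exists_common_point (m := k + k) hF
    (D := fun x z => InBox (fun i => z (Fin.castAdd k i)) (fun i => z (Fin.natAdd k i)) (v x) ∧
      Q x (fun i => z (Fin.castAdd k i)) (fun i => z (Fin.natAdd k i)))
    (.and (.inBox hM (hlo.comp (.snd .id)) (hhi.comp (.snd .id)) (hv.comp (.fst .id)))
      (hQ.comp₃ (.fst .id) (hlo.comp (.snd .id)) (hhi.comp (.snd .id)))) hinf fun x hx => by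
      obtain ⟨u, w, huw, h⟩ := hbox x hx
      refine ⟨Fin.append u (v x), Fin.append (v x) w, fun i => ?_, fun z hz => ?_⟩
      · refine Fin.addCases (fun i => ?_) (fun i => ?_) i
        · simpa only [Fin.append_left] using (huw i).1
        · simpa only [Fin.append_right] using (huw i).2
      · have h₁ := fun i => hz (Fin.castAdd k i)
        have h₂ := fun i => hz (Fin.natAdd k i)
        simp only [Fin.append_left, Fin.append_right] at h₁ h₂
        have h' : InBox (fun i => z (Fin.castAdd k i)) (fun i => z (Fin.natAdd k i)) (v x) :=
          fun i => ⟨(h₁ i).2, (h₂ i).1⟩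
        exact ⟨h', hmono _ _ _ _ _ h h' (fun i => (h₁ i).1.le) fun i => (h₂ i).2.le⟩
  exact ⟨_, _, hz⟩

end UniformBoxes

section Thin

variable {L : FirstOrder.Language} {M : Type} [L.Structure M] [LinearOrder M]
  {X Γ : Type} [DSp L M X] [DSp L M Γ] {k : ℕ}

/-- All but finitely many fibres of each coordinate of `v` are finite. -/
def Thin (v : Γ → Fin k → M) : Prop := ∀ j, {t | {x | v x j = t}.Infinite}.Finite

omit [L.Structure M] [LinearOrder M] [DSp L M Γ] in
lemma exists_infinite_image_coord {v : Γ → Fin k → M} (hv : Function.Injective v) {S : Set Γ}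
    (hS : S.Infinite) : ∃ j, ((fun x => v x j) '' S).Infinite := by
  by_contra! h
  refine (hS.image hv.injOn) ((Set.Finite.pi' h).subset ?_)
  rintro _ ⟨x, hx, rfl⟩ j
  exact ⟨x, hx, rfl⟩

/-- A definable relation between an interpretable set and a thin set having infinitely many
infinite fibres on one side has an infinite fibre on the other. -/
theorem OMinimal.exists_infinite_fibre (hM : OMinimal L M) {v : Γ → Fin k → M} (hv : DMap L M v)
    (hinj : Function.Injective v) (hthin : Thin v) {R : X → Γ → Prop}
    (hR : Dp L M fun p : X × Γ => R p.1 p.2) (hinf : {x | {y | R x y}.Infinite}.Infinite) :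
    ∃ y, {x | R x y}.Infinite := by
  have := hM.1
  obtain ⟨j, hj⟩ : ∃ j, {x | {s | ∃ y, R x y ∧ v y j = s}.Infinite}.Infinite := by
    by_contra! h
    refine hinf ((Set.finite_iUnion h).subset fun x hx => ?_)
    obtain ⟨j, hj⟩ := exists_infinite_image_coord hinj hx
    exact Set.mem_iUnion.2 ⟨j, hj⟩
  obtain ⟨u, w, huw, h⟩ := hM.exists_common_interval (D := fun x s => ∃ y, R x y ∧ v y j = s) (by
    refine .ex (.and (hR.comp₂ ?_ ?_) (.eq ?_ ?_)) <;> fun_prop) hj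
  obtain ⟨s, hs, hs'⟩ := ((Set.Ioo_infinite huw).sdiff (hthin j)).nonempty
  by_contra! hcon
  refine h (((Set.not_infinite.1 hs').biUnion fun y _ => hcon y).subset fun x hx => ?_)
  obtain ⟨y, hy, hys⟩ := hx s hs.1 hs.2
  exact Set.mem_biUnion (x := y) hys hy

/-- Definable choice in finite fibres of a coordinate. -/
lemma OMinimal.exists_section (hM : OMinimal L M) {v : Γ → Fin k → M} (hv : DMap L M v)
    (hinj : Function.Injective v) {C : Γ → Prop} (hC : Dp L M C) (j : Fin k) {I : Set M}
    (hfin : ∀ s ∈ I, {x | v x j = s}.Finite) (hne : ∀ s ∈ I, ∃ x, C x ∧ v x j = s) :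
    ∃ S : Γ → Prop, Dp L M S ∧ (∀ x, S x → C x) ∧ (∀ s ∈ I, ∃ x, S x ∧ v x j = s) ∧
      ∀ x y, S x → S y → v x j = v y j → x = y := by
  suffices h : ∀ m ≤ k, ∃ S : Γ → Prop, Dp L M S ∧ (∀ x, S x → C x) ∧
      (∀ s ∈ I, ∃ x, S x ∧ v x j = s) ∧
      ∀ x y, S x → S y → v x j = v y j → ∀ i : Fin k, i.1 < m → v x i = v y i by
    obtain ⟨S, hS, hSC, hSI, huniq⟩ := h k le_rfl
    exact ⟨S, hS, hSC, hSI, fun x y hx hy hxy => hinj (funext fun i => huniq x y hx hy hxy i i.2)⟩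
  intro m hm
  induction m with
  | zero => exact ⟨C, hC, fun _ h => h, hne, fun _ _ _ _ _ i hi => absurd hi (Nat.not_lt_zero _)⟩
  | succ m ih =>
    obtain ⟨S, hS, hSC, hSI, huniq⟩ := ih (Nat.le_of_succ_le hm)
    let l : Fin k := ⟨m, hm⟩
    refine ⟨fun x => S x ∧ ∀ y, S y → v y j = v x j → v x l ≤ v y l, ?_, fun x hx => hSC x hx.1,
      fun s hs => ?_, fun x y hx hy hxy i hi => ?_⟩
    · refine .and hS (.all (.imp (hS.comp ?_) (.imp (.eq ?_ ?_) (.le hM ?_ ?_)))) <;> fun_prop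
    · obtain ⟨x₀, hx₀, hx₀s⟩ := hSI s hs
      obtain ⟨x, ⟨hxS, hxs⟩, hmin⟩ := Set.exists_min_image {x | S x ∧ v x j = s} (fun x => v x l)
        ((hfin s hs).subset fun x hx => hx.2) ⟨x₀, hx₀, hx₀s⟩
      exact ⟨x, ⟨hxS, fun y hy hyx => hmin y ⟨hy, hyx.trans hxs⟩⟩, hxs⟩
    · rcases Nat.lt_succ_iff_lt_or_eq.1 hi with hi | hi
      · exact huniq x y hx.1 hy.1 hxy i hi
      · obtain rfl : i = l := Fin.ext hi
        exact le_antisymm (hx.2 y hy.1 hxy.symm) (hy.2 x hx.1 hxy)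

end Thin

section Closures

variable {L : FirstOrder.Language} {M : Type} [L.Structure M] [LinearOrder M]
  {X Y Γ : Type} [DSp L M X] [DSp L M Y] [DSp L M Γ] {k : ℕ}

/-- The point `x` lies in the closure of the image under `v` of the set `S`. -/
def Cl (v : Γ → Fin k → M) (S : Γ → Prop) (x : Fin k → M) : Prop :=
  ∀ u w, InBox u w x → ∃ y, S y ∧ InBox u w (v y)

lemma Dp.cl (hM : OMinimal L M) {v : Γ → Fin k → M} (hv : DMap L M v) {S : X → Γ → Prop}
    (hS : Dp L M fun p : X × Γ => S p.1 p.2) {f : X → Fin k → M} (hf : DMap L M f) :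
    Dp L M fun x => Cl v (S x) (f x) := by
  refine .all (.all (.imp (.inBox hM ?_ ?_ ?_)
    (.ex (.and (hS.comp₂ ?_ ?_) (.inBox hM ?_ ?_ ?_))))) <;> fun_prop

omit [LinearOrder M] in
lemma Dp.mem_of_finite {s : Set X} (hs : s.Finite) : Dp L M fun x => x ∈ s := by
  have := hs.to_subtype
  have h : Dp L M fun x => ∃ i : s, x = i.1 :=
    .exists_of_finite fun i => .eq (by fun_prop) (by fun_prop)
  simpa using h

omit [L.Structure M] in
lemma exists_box_disjoint [NoMaxOrder M] [NoMinOrder M] {S : Set (Fin k → M)} (hS : S.Finite)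
    {x : Fin k → M} (hx : x ∉ S) : ∃ u w, InBox u w x ∧ ∀ y ∈ S, ¬ InBox u w y := by
  have hw : ∀ i, ∃ w > x i, ∀ z ∈ (· i) '' S, x i < z → w ≤ z := fun i =>
    exists_gt_le_of_finite (hS.image _) _
  have hu : ∀ i, ∃ u < x i, ∀ z ∈ (· i) '' S, z < x i → z ≤ u := fun i =>
    @exists_gt_le_of_finite M (dualOrder M) (inferInstanceAs (NoMaxOrder Mᵒᵈ)) _ (hS.image _) _
  choose w hw hw' using hw
  choose u hu hu' using hu
  refine ⟨u, w, fun i => ⟨hu i, hw i⟩, fun y hy h => hx ?_⟩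
  convert hy using 1
  funext i
  refine le_antisymm (not_lt.1 fun hlt => ?_) (not_lt.1 fun hlt => ?_)
  · exact absurd (hu' i _ ⟨y, hy, rfl⟩ hlt) (not_le.2 (h i).1)
  · exact absurd (hw' i _ ⟨y, hy, rfl⟩ hlt) (not_le.2 (h i).2)

omit [L.Structure M] [LinearOrder M] [DSp L M X] in
lemma infinite_image_of_finite_fibres {v : X → Fin k → M} {j : Fin k} {F : X → Prop}
    (hfin : ∀ x, F x → {y | F y ∧ v y j = v x j}.Finite) (hinf : {x | F x}.Infinite) :
    {t | ∃ x, F x ∧ v x j = t}.Infinite := fun h => by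
  refine hinf ((h.biUnion (t := fun t => {y | F y ∧ v y j = t}) ?_).subset fun x hx =>
    Set.mem_biUnion (x := v x j) ⟨x, hx, rfl⟩ ⟨hx, rfl⟩)
  rintro _ ⟨x, hx, rfl⟩
  exact hfin x hx

/-- Two disjoint definable sets with generically finite fibres over a coordinate: over all but
finitely many values of that coordinate, no point of one lies in the closure of the other. -/
theorem OMinimal.finite_frontier_coord (hM : OMinimal L M) {v : Γ → Fin k → M} (hv : DMap L M v)
    {v' : X → Fin k → M} (hv' : DMap L M v') {c : Γ → Prop} (hc : Dp L M c) {F : X → Prop}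
    (hF : Dp L M F) (hdisj : ∀ x y, F x → c y → v y ≠ v' x) (j : Fin k)
    (hcfin : {t | {y | c y ∧ v y j = t}.Infinite}.Finite)
    (hFfin : {t | {x | F x ∧ v' x j = t}.Infinite}.Finite) :
    {t | ∃ x, F x ∧ v' x j = t ∧ Cl v c (v' x)}.Finite := by
  have := hM.1
  have := hM.2.1
  have := hM.2.2.1
  by_contra hinf
  set N := {t | {y | c y ∧ v y j = t}.Infinite} ∪ {t | {x | F x ∧ v' x j = t}.Infinite}
  have hN : N.Finite := hcfin.union hFfin
  let F₂ : X → Prop := fun x => (F x ∧ Cl v c (v' x)) ∧ v' x j ∉ N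
  have hF₂ : Dp L M F₂ := by
    refine .and (.and hF (.cl (S := fun _ => c) hM hv (hc.comp ?_) ?_))
      (.not ((Dp.mem_of_finite hN).comp (f := fun x => v' x j) ?_)) <;> fun_prop
  have hfib : ∀ x, F₂ x → {y | F y ∧ v' y j = v' x j}.Finite := fun x hx =>
    Set.not_infinite.1 fun h => hx.2 (.inr h)
  have hF₂inf : {x | F₂ x}.Infinite := by
    refine fun h => (Set.Infinite.sdiff hinf hN) ((h.image fun x => v' x j).subset ?_)
    rintro t ⟨⟨x, hx, rfl, hcl⟩, ht⟩
    exact ⟨x, ⟨⟨hx, hcl⟩, ht⟩, rfl⟩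
  obtain ⟨u, w, huw⟩ := hM.exists_common_box hF₂ hv'
    (Q := fun x u w => ∀ y, c y → v y j = v' x j → ¬ InBox u w (v y)) (by
      refine .all (.imp (hc.comp ?_) (.imp (.eq ?_ ?_) (.not (.inBox hM ?_ ?_ ?_)))) <;> fun_prop)
    (fun x u w u' w' h _ hu hw y hy hyx hb =>
      h y hy hyx fun i => ⟨(hu i).trans_lt (hb i).1, (hb i).2.trans_le (hw i)⟩)
    hF₂inf fun x hx => by
      obtain ⟨u, w, hb, h⟩ := exists_box_disjoint
        ((Set.not_infinite.1 fun h => hx.2 (.inl h) : {y | c y ∧ v y j = v' x j}.Finite).image v)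
        (x := v' x) (by rintro ⟨y, hy, hyx⟩; exact hdisj x y hx.1.1 hy.1 hyx)
      exact ⟨u, w, hb, fun y hy hyx => h _ ⟨y, ⟨hy, hyx⟩, rfl⟩⟩
  set F₃ : X → Prop := fun x => F₂ x ∧ InBox u w (v' x) ∧
    ∀ y, c y → v y j = v' x j → ¬ InBox u w (v y)
  have hF₃ : Dp L M F₃ := by
    refine .and hF₂ (.and (.inBox hM ?_ ?_ ?_) (.all (.imp (hc.comp ?_) (.imp (.eq ?_ ?_)
      (.not (.inBox hM ?_ ?_ ?_)))))) <;> fun_prop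
  obtain ⟨p, q, hpq, h⟩ := hM.exists_interval (s := fun t => ∃ x, F₃ x ∧ v' x j = t) (by
    refine .ex (.and (hF₃.comp ?_) (.eq ?_ ?_)) <;> fun_prop)
    (infinite_image_of_finite_fibres (fun x hx => (hfib x hx.1).subset
      fun y hy => ⟨hy.1.1.1.1, hy.2⟩) huw)
  obtain ⟨t, hpt, htq⟩ := exists_between hpq
  obtain ⟨x, hx, rfl⟩ := h t hpt htq
  obtain ⟨y, hy, hb⟩ := hx.1.1.2 (Function.update u j (max (u j) p))
    (Function.update w j (min (w j) q)) fun i => by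
      have := hx.2.1 i
      rcases eq_or_ne i j with rfl | hi
      · simpa using ⟨⟨this.1, hpt⟩, this.2, htq⟩
      · simpa [hi] using this
  have hj := hb j
  simp only [Function.update_self, max_lt_iff, lt_min_iff] at hj
  obtain ⟨x', hx', hxy⟩ := h (v y j) hj.1.2 hj.2.2
  refine hx'.2.2 y hy hxy.symm fun i => ?_
  rcases eq_or_ne i j with rfl | hi
  · exact ⟨hj.1.1, hj.2.1⟩
  · simpa [hi] using hb i

/-- In a thin space, only finitely many points of a definable set lie in the closure of a disjoint
definable set. -/
theorem OMinimal.finite_frontier (hM : OMinimal L M) {v : Γ → Fin k → M} (hv : DMap L M v)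
    (hinj : Function.Injective v) (hthin : Thin v) {c F : Γ → Prop} (hc : Dp L M c)
    (hF : Dp L M F) (hdisj : ∀ x, F x → ¬ c x) : {x | F x ∧ Cl v c (v x)}.Finite := by
  by_contra h
  obtain ⟨j, hj⟩ := exists_infinite_image_coord hinj h
  refine hj ((hM.finite_frontier_coord hv hv hc hF
    (fun x y hx hy hxy => hdisj x hx (hinj hxy ▸ hy)) j
    ((hthin j).subset fun t ht => Set.Infinite.mono (fun y hy => hy.2) ht)
    ((hthin j).subset fun t ht => Set.Infinite.mono (fun y hy => hy.2) ht)).subset ?_)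
  rintro _ ⟨x, hx, rfl⟩
  exact ⟨x, hx.1, rfl, hx.2⟩

/-- A map `f` between subsets of `M ^ k` is discontinuous at `x`. -/
def DiscAt (v : Γ → Fin k → M) (f : Γ → Γ) (x : Γ) : Prop :=
  ∃ u w, InBox u w (v (f x)) ∧ Cl v (fun y => ¬ InBox u w (v (f y))) (v x)

lemma OMinimal.finite_discAt (hM : OMinimal L M) {v : Γ → Fin k → M} (hv : DMap L M v)
    (hinj : Function.Injective v) (hthin : Thin v) {f : Γ → Γ} (hf : DMap L M f) :
    {x | DiscAt v f x}.Finite := by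
  by_contra h
  have hQ : Dp L M fun p : Γ × (Fin k → M) × (Fin k → M) =>
      Cl v (fun y => ¬ InBox p.2.1 p.2.2 (v (f y))) (v p.1) := by
    refine .cl hM hv (.not (.inBox hM ?_ ?_ ?_)) ?_ <;> fun_prop
  obtain ⟨u, w, huw⟩ := hM.exists_common_box (F := DiscAt v f) (v := fun x => v (f x))
    (Q := fun x u w => Cl v (fun y => ¬ InBox u w (v (f y))) (v x)) (by
      refine .ex (.ex (.and (.inBox hM ?_ ?_ ?_) (.cl hM hv (.not (.inBox hM ?_ ?_ ?_)) ?_)))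
        <;> fun_prop) (by fun_prop) hQ (fun x u w u' w' hcl _ hu hw a b hab => by
      obtain ⟨y, hy, hby⟩ := hcl a b hab
      exact ⟨y, fun hb => hy fun i => ⟨(hu i).trans_lt (hb i).1, (hb i).2.trans_le (hw i)⟩, hby⟩)
    h fun x hx => hx
  have hbox : Dp L M fun x => InBox u w (v (f x)) := by refine .inBox hM ?_ ?_ ?_ <;> fun_prop
  exact huw ((hM.finite_frontier hv hinj hthin hbox.not hbox fun x hx => not_not.2 hx).subset
    fun x hx => hx.2)

end Closures

section Germs

variable {L : FirstOrder.Language} {M : Type} [L.Structure M] [LinearOrder M]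
  {Γ : Type} [DSp L M Γ] {k : ℕ} {v : Γ → Fin k → M}

/-- Generically, a point of a thin space is approximated by points with larger `j`-coordinate. -/
lemma OMinimal.finite_not_cl_gt (hM : OMinimal L M) (hv : DMap L M v) (hthin : Thin v)
    (j : Fin k) : {t | ∃ x, v x j = t ∧ ¬ Cl v (fun y => v x j < v y j) (v x)}.Finite := by
  by_contra hinf
  set F : Γ → Prop := fun x => ¬ Cl v (fun y => v x j < v y j) (v x) ∧
    v x j ∉ {t | {x | v x j = t}.Infinite}
  have hF : Dp L M F := by
    refine .and (.not (.cl hM hv (.lt hM ?_ ?_) ?_))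
      (.not ((Dp.mem_of_finite (hthin j)).comp (f := fun x => v x j) ?_)) <;> fun_prop
  have hFinf : {x | F x}.Infinite := by
    refine fun h => (Set.Infinite.sdiff hinf (hthin j)) ((h.image fun x => v x j).subset ?_)
    rintro t ⟨⟨x, rfl, hx⟩, ht⟩
    exact ⟨x, ⟨hx, ht⟩, rfl⟩
  obtain ⟨u, w, h⟩ := hM.exists_common_box hF hv
    (Q := fun x u w => ∀ y, v x j < v y j → ¬ InBox u w (v y)) (by
      refine .all (.imp (.lt hM ?_ ?_) (.not (.inBox hM ?_ ?_ ?_))) <;> fun_prop)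
    (fun x u w u' w' h _ hu hw y hy hb =>
      h y hy fun i => ⟨(hu i).trans_lt (hb i).1, (hb i).2.trans_le (hw i)⟩) hFinf fun x hx => by
      have := hx.1
      unfold Cl at this
      push Not at this
      exact this
  obtain ⟨s, ⟨x, hx, rfl⟩, t, ⟨y, hy, rfl⟩, hst⟩ := (infinite_image_of_finite_fibres (v := v)
    (j := j) (fun x hx => (Set.not_infinite.1 hx.1.2).subset fun y hy => hy.2) h).nontrivial
  rcases lt_or_gt_of_ne hst with hlt | hlt
  · exact hx.2.2 y hlt hy.2.1
  · exact hy.2.2 x hlt hx.2.1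

/-- The `l`-coordinate of a thin space is bounded above near almost all values of the
`j`-coordinate. -/
lemma OMinimal.finite_unbounded (hM : OMinimal L M) (hv : DMap L M v) (hthin : Thin v)
    (j l : Fin k) :
    {t | ∀ b p q, p < t → t < q → ∃ x, p < v x j ∧ v x j < q ∧ b < v x l}.Finite := by
  by_contra hinf
  have := hM.1
  have := hM.2.2.1
  set E : M → Prop := fun t => ∀ b p q, p < t → t < q → ∃ x, p < v x j ∧ v x j < q ∧ b < v x l
  have hE : Dp L M E := by
    refine .all (.all (.all (.imp (.lt hM ?_ ?_) (.imp (.lt hM ?_ ?_) (.ex (.and (.lt hM ?_ ?_)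
      (.and (.lt hM ?_ ?_) (.lt hM ?_ ?_)))))))) <;> fun_prop
  obtain ⟨p, q, a, b, hpq, hab, h⟩ := hM.exists_planar_box
    (D := fun t z => E t ∧ ∀ x, v x j = t → v x l ≤ z) (by
      refine .and (hE.comp ?_) (.all (.imp (.eq ?_ ?_) (.le hM ?_ ?_))) <;> fun_prop) <| by
    refine Set.Infinite.mono ?_ (Set.Infinite.sdiff hinf (hthin j))
    rintro t ⟨ht, htfin⟩
    have hne : Nonempty M := ⟨t⟩
    obtain ⟨z₀, hz₀⟩ := ((Set.not_infinite.1 htfin).image fun x => v x l).bddAbove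
    exact (Set.Ioi_infinite z₀).mono fun z hz => ⟨ht, fun x hx =>
      (hz₀ ⟨x, hx, rfl⟩).trans (le_of_lt hz)⟩
  obtain ⟨t, hpt, htq⟩ := exists_between hpq
  obtain ⟨z, haz, hzb⟩ := exists_between hab
  obtain ⟨x, hpx, hxq, hzx⟩ := (h t z hpt htq haz hzb).1 z p q hpt htq
  exact absurd ((h _ z hpx hxq haz hzb).2 x rfl) (not_le.2 hzx)

lemma OMinimal.finite_unbounded_below (hM : OMinimal L M) (hv : DMap L M v) (hthin : Thin v)
    (j l : Fin k) :
    {t | ∀ b p q, p < t → t < q → ∃ x, p < v x j ∧ v x j < q ∧ v x l < b}.Finite := by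
  refine (@OMinimal.finite_unbounded L M _ (dualOrder M) Γ _ k v hM.dual hv hthin j l).subset ?_
  intro t ht b p q hp hq
  obtain ⟨x, h₁, h₂, h₃⟩ := ht b q p hq hp
  exact ⟨x, h₂, h₁, h₃⟩

/-- Over almost all values of the `j`-coordinate, a thin set is closed. -/
lemma OMinimal.finite_frontier_range (hM : OMinimal L M) (hv : DMap L M v) (hthin : Thin v)
    (j : Fin k) :
    {t | ∃ x : Fin k → M, (∀ y, v y ≠ x) ∧ x j = t ∧ Cl v (fun _ => True) x}.Finite := by
  have := hM.1
  have := hM.2.1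
  have := hM.2.2.1
  set P : Fin k → M → M → Prop := fun l t z => ∀ p q a b, p < t → t < q → a < z → z < b →
    ∃ y, p < v y j ∧ v y j < q ∧ a < v y l ∧ v y l < b
  have hP : ∀ l, Dp L M fun p : M × M => P l p.1 p.2 := fun l => by
    refine .all (.all (.all (.all (.imp (.lt hM ?_ ?_) (.imp (.lt hM ?_ ?_) (.imp (.lt hM ?_ ?_)
      (.imp (.lt hM ?_ ?_) (.ex (.and (.lt hM ?_ ?_) (.and (.lt hM ?_ ?_) (.and (.lt hM ?_ ?_)
      (.lt hM ?_ ?_)))))))))))) <;> fun_prop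
  have hPfin : ∀ l, {t | {z | P l t z}.Infinite}.Finite := fun l => by
    by_contra hinf
    obtain ⟨p, q, a, b, hpq, hab, h⟩ := hM.exists_planar_box (hP l) hinf
    obtain ⟨p', q', a', b', hpq', hab', h'⟩ := hM.exists_planar_box
      (D := fun t z => (p < t ∧ t < q) ∧ (a < z ∧ z < b) ∧ ∀ y, v y j = t → v y l ≠ z) (by
        refine .and (.and (.lt hM ?_ ?_) (.lt hM ?_ ?_)) (.and (.and (.lt hM ?_ ?_) (.lt hM ?_ ?_))
          (.all (.imp (.eq ?_ ?_) (.not (.eq ?_ ?_))))) <;> fun_prop) <| by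
      refine Set.Infinite.mono ?_ ((Set.Ioo_infinite hpq).sdiff (hthin j))
      rintro t ⟨ht, htfin⟩
      refine Set.Infinite.mono ?_ ((Set.Ioo_infinite hab).sdiff
        ((Set.not_infinite.1 htfin).image fun y => v y l))
      rintro z ⟨hz, hz'⟩
      exact ⟨ht, hz, fun y hy hyz => hz' ⟨y, hy, hyz⟩⟩
    obtain ⟨t, hpt, htq⟩ := exists_between hpq'
    obtain ⟨z, haz, hzb⟩ := exists_between hab'
    have h₀ := h' t z hpt htq haz hzb
    obtain ⟨y, h₁, h₂, h₃, h₄⟩ :=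
      h t z h₀.1.1 h₀.1.2 h₀.2.1.1 h₀.2.1.2 p' q' a' b' hpt htq haz hzb
    exact (h' _ _ h₁ h₂ h₃ h₄).2.2 y rfl rfl
  have hF : Dp L M fun x : Fin k → M => (∀ y, v y ≠ x) ∧ Cl v (fun _ => True) x := by
    refine .and (.all (.not (.eq ?_ ?_))) (.cl hM hv (.const _) ?_) <;> fun_prop
  have := hM.finite_frontier_coord hv (v' := fun x : Fin k → M => x) (by fun_prop)
    (c := fun _ => True) (.const _) hF (fun x y hx _ => hx.1 y) j
    ((hthin j).subset fun t ht => Set.Infinite.mono (fun y hy => hy.2) ht) <| by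
    refine (Set.finite_iUnion hPfin).subset fun t ht => ?_
    obtain ⟨l, hl⟩ := exists_infinite_image_coord Function.injective_id ht
    refine Set.mem_iUnion.2 ⟨l, hl.mono ?_⟩
    rintro _ ⟨x, ⟨⟨-, hx⟩, rfl⟩, rfl⟩ p q a b hp hq ha hb
    choose lo hlo using fun i => exists_lt (x i)
    choose hi hhi using fun i => exists_gt (x i)
    obtain ⟨y, -, hy⟩ := hx
      (fun i => max (if i = j then p else lo i) (if i = l then a else lo i))
      (fun i => min (if i = j then q else hi i) (if i = l then b else hi i)) fun i => by
        have := hlo i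
        have := hhi i
        simp only [max_lt_iff, lt_min_iff]
        split_ifs <;> subst_vars <;> tauto
    have hj := hy j
    have hl := hy l
    simp only [max_lt_iff, lt_min_iff, if_true] at hj hl
    exact ⟨y, hj.1.1, hj.2.1, hl.1.2, hl.2.2⟩
  exact this.subset fun t ⟨x, hx, hxt, hcl⟩ => ⟨x, ⟨hx, hcl⟩, hxt, hcl⟩

omit [L.Structure M] [DSp L M Γ] in
lemma exists_common_gt [NoMaxOrder M] {P : Fin k → Γ → Prop} {j : Fin k} {S : Γ → Prop} {t : M}
    (h : ∀ i, ∃ u > t, ∀ x, S x → t < v x j → v x j < u → P i x) :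
    ∃ u > t, ∀ x, S x → t < v x j → v x j < u → ∀ i, P i x := by
  choose u hu h using h
  obtain ⟨w, hw, hle⟩ := exists_gt_le_of_finite (Set.finite_range u) t
  exact ⟨w, hw, fun x hx hlt hlt' i => h i x hx hlt (hlt'.trans_le (hle _ ⟨i, rfl⟩ (hu i)))⟩

/-- Near `t` from the right, a section of the `j`-coordinate either has or avoids a definable
property. -/
lemma OMinimal.section_germ (hM : OMinimal L M) (hv : DMap L M v) {S P : Γ → Prop} {j : Fin k}
    (hS : Dp L M S) (huniq : ∀ x y, S x → S y → v x j = v y j → x = y) (hP : Dp L M P) (t : M) :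
    (∃ u > t, ∀ x, S x → t < v x j → v x j < u → P x) ∨
      ∃ u > t, ∀ x, S x → t < v x j → v x j < u → ¬ P x := by
  rcases hM.right_germ (s := fun z => ∃ x, S x ∧ v x j = z ∧ P x) (by
    refine .ex (.and (hS.comp ?_) (.and (.eq ?_ ?_) (hP.comp ?_))) <;> fun_prop) t with
    ⟨u, hu, h⟩ | ⟨u, hu, h⟩
  · refine .inl ⟨u, hu, fun x hx hlt hlt' => ?_⟩
    obtain ⟨y, hy, hyx, hPy⟩ := h _ hlt hlt'
    exact huniq _ _ hy hx hyx ▸ hPy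
  · exact .inr ⟨u, hu, fun x hx hlt hlt' hPx => h _ hlt hlt' ⟨x, hx, rfl, hPx⟩⟩

/-- A locally bounded definable section has a right limit. -/
theorem OMinimal.exists_right_limit (hM : OMinimal L M) (hv : DMap L M v) {S : Γ → Prop}
    {j : Fin k} (hS : Dp L M S) (huniq : ∀ x y, S x → S y → v x j = v y j → x = y) {t : M}
    (hne : ∀ u > t, ∃ x, S x ∧ t < v x j ∧ v x j < u)
    (hbdd : ∀ l, ∃ b, ∃ u > t, ∀ x, S x → t < v x j → v x j < u → v x l ≤ b)
    (hbdd' : ∀ l, ∃ b, ∃ u > t, ∀ x, S x → t < v x j → v x j < u → b ≤ v x l) :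
    ∃ z, z j = t ∧ Cl v S z := by
  have := hM.1
  have := hM.2.1
  have := hM.2.2.1
  have both : ∀ {P Q : Γ → Prop}, (∃ u > t, ∀ x, S x → t < v x j → v x j < u → P x) →
      (∃ u > t, ∀ x, S x → t < v x j → v x j < u → Q x) → ∃ x, S x ∧ t < v x j ∧ P x ∧ Q x := by
    rintro P Q ⟨u, hu, h⟩ ⟨u', hu', h'⟩
    obtain ⟨x, hx, hlt, hlt'⟩ := hne _ (lt_min hu hu')
    rw [lt_min_iff] at hlt'
    exact ⟨x, hx, hlt, h x hx hlt hlt'.1, h' x hx hlt hlt'.2⟩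
  have key : ∀ l, ∃ c, (∀ a < c, ∃ u > t, ∀ x, S x → t < v x j → v x j < u → a < v x l) ∧
      ∀ b > c, ∃ u > t, ∀ x, S x → t < v x j → v x j < u → v x l < b := fun l => by
    obtain ⟨c, hc⟩ := hM.exists_isLUB
      (s := fun a => ∃ u > t, ∀ x, S x → t < v x j → v x j < u → a < v x l) (by
        refine .ex (.and (.lt hM ?_ ?_) (.all (.imp (hS.comp ?_) (.imp (.lt hM ?_ ?_)
          (.imp (.lt hM ?_ ?_) (.lt hM ?_ ?_)))))) <;> fun_prop)
      (by
        obtain ⟨b, u, hu, h⟩ := hbdd' l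
        obtain ⟨a, ha⟩ := exists_lt b
        exact ⟨a, u, hu, fun x hx h₁ h₂ => ha.trans_le (h x hx h₁ h₂)⟩)
      (by
        obtain ⟨b, hb⟩ := hbdd l
        refine ⟨b, fun a ha => ?_⟩
        obtain ⟨x, -, -, h₁, h₂⟩ := both hb ha
        exact (h₂.trans_le h₁).le)
    refine ⟨c, fun a ha => ?_, fun b hb => ?_⟩
    · obtain ⟨a', ⟨u, hu, h⟩, haa'⟩ := (lt_isLUB_iff hc).1 ha
      exact ⟨u, hu, fun x hx h₁ h₂ => haa'.trans (h x hx h₁ h₂)⟩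
    · obtain ⟨b', hb', hbb'⟩ := exists_between (show c < b from hb)
      rcases hM.section_germ hv (P := fun x => b' < v x l) hS huniq (.lt hM (by fun_prop)
        (by fun_prop)) t with h | ⟨u, hu, h⟩
      · exact absurd (hc.1 h) (not_le.2 hb')
      · exact ⟨u, hu, fun x hx h₁ h₂ => (not_lt.1 (h x hx h₁ h₂)).trans_lt hbb'⟩
  choose z hz hz' using key
  refine ⟨z, le_antisymm (not_lt.1 fun hlt => ?_) (not_lt.1 fun hlt => ?_), fun u w h => ?_⟩
  · obtain ⟨a, hta, haz⟩ := exists_between hlt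
    obtain ⟨x, -, -, h₁, h₂⟩ := both (Q := fun x => v x j < a) (hz j a haz)
      ⟨a, hta, fun x _ _ h => h⟩
    exact lt_asymm h₁ h₂
  · obtain ⟨x, -, h₁, h₂, -⟩ := both (hz' j t hlt) (hz' j t hlt)
    exact lt_asymm h₁ h₂
  · obtain ⟨b, hb, hbox⟩ := exists_common_gt (P := fun i x => u i < v x i ∧ v x i < w i)
      (v := v) (S := S) (j := j) (t := t) fun i => by
        obtain ⟨p, hp, h₁⟩ := hz i _ (h i).1
        obtain ⟨q, hq, h₂⟩ := hz' i _ (h i).2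
        exact ⟨min p q, lt_min hp hq, fun x hx hlt hlt' => ⟨h₁ x hx hlt (lt_min_iff.1 hlt').1,
          h₂ x hx hlt (lt_min_iff.1 hlt').2⟩⟩
    obtain ⟨x, hx, h₁, h₂⟩ := hne b hb
    exact ⟨x, hx, hbox x hx h₁ h₂⟩

end Germs

section Cosets

variable {L : FirstOrder.Language} {M : Type} [L.Structure M]
  {X Γ : Type} [DSp L M X] [DSp L M Γ] [AddCommGroup Γ] {k : ℕ} {v : Γ → Fin k → M}

/-- The addition of `Γ` is definable. -/
class DefAdd (L : FirstOrder.Language) (M : Type) [L.Structure M] (Γ : Type) [DSp L M Γ]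
    [AddCommGroup Γ] : Prop where
  dmap_add : DMap L M fun p : Γ × Γ => p.1 + p.2

variable [DefAdd L M Γ]

@[fun_prop]
lemma DMap.add {f g : X → Γ} (hf : DMap L M f) (hg : DMap L M g) :
    DMap L M fun x => f x + g x :=
  DefAdd.dmap_add.comp (hf.prodMk hg)

@[fun_prop]
lemma DMap.neg {f : X → Γ} (hf : DMap L M f) : DMap L M fun x => - f x := by
  have h : Dp L M fun p : X × Γ => f p.1 + p.2 = 0 := .eq (by fun_prop) (by fun_prop)
  simpa only [DMap, neg_eq_iff_add_eq_zero] using h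

@[fun_prop]
lemma DMap.sub {f g : X → Γ} (hf : DMap L M f) (hg : DMap L M g) :
    DMap L M fun x => f x - g x := by
  simp only [sub_eq_add_neg]
  fun_prop

variable [LinearOrder M]

/-- Only finitely many points lie on the boundary of their coset of a definable subgroup of finite
index. -/
lemma OMinimal.finite_boundary (hM : OMinimal L M) (hv : DMap L M v)
    (hinj : Function.Injective v) (hthin : Thin v) {B : AddSubgroup Γ} (hB : Dp L M (· ∈ B))
    [B.FiniteIndex] : {x | Cl v (fun y => y - x ∉ B) (v x)}.Finite := by
  refine (Set.finite_iUnion (ι := Γ ⧸ B)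
    (f := fun q => {x | x - q.out ∈ B ∧ Cl v (fun y => y - q.out ∉ B) (v x)}) fun q => ?_).subset
    fun x hx => Set.mem_iUnion.2 ⟨(x : Γ ⧸ B), ?_⟩
  · have : Dp L M fun x => x - q.out ∈ B := hB.comp (f := fun x => x - q.out) (by fun_prop)
    exact hM.finite_frontier hv hinj hthin this.not this fun x hx => not_not.2 hx
  · have hmem : x - (x : Γ ⧸ B).out ∈ B := by
      rw [← QuotientAddGroup.eq_zero_iff, QuotientAddGroup.mk_sub, QuotientAddGroup.out_eq',
        sub_self]
    refine ⟨hmem, fun u w h => ?_⟩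
    obtain ⟨y, hy, hb⟩ := hx u w h
    refine ⟨y, fun hy' => hy ?_, hb⟩
    simpa using B.sub_mem hy' hmem

/-- Finitely many points contain the boundary points of the cosets of all definable subgroups of
finite index. -/
theorem OMinimal.exists_finite_boundary [Infinite Γ] (hM : OMinimal L M) (hv : DMap L M v)
    (hinj : Function.Injective v) (hthin : Thin v) :
    ∃ X₀ : Set Γ, X₀.Finite ∧ ∀ B : AddSubgroup Γ, Dp L M (· ∈ B) → B.FiniteIndex →
      ∀ x, Cl v (fun y => y - x ∉ B) (v x) → x ∈ X₀ := by
  refine ⟨{x | {a | DiscAt v (· + a) x}.Infinite}, ?_, fun B hB _ x hx => ?_⟩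
  · by_contra h
    have hR : Dp L M fun p : Γ × Γ => DiscAt v (· + p.2) p.1 := by
      refine .ex (.ex (.and (.inBox hM ?_ ?_ ?_) (.cl hM hv (.not (.inBox hM ?_ ?_ ?_)) ?_)))
        <;> fun_prop
    obtain ⟨a, ha⟩ := hM.exists_infinite_fibre hv hinj hthin
      (R := fun x a => DiscAt v (· + a) x) hR h
    exact ha (hM.finite_discAt hv hinj hthin (by fun_prop))
  · intro hfin
    refine Set.infinite_univ (α := Γ) ((hfin.union
      (((hM.finite_boundary hv hinj hthin hB).preimage (f := fun a => x + a)
        (add_right_injective x).injOn))).subset fun a _ => ?_)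
    by_cases ha : DiscAt v (· + a) x
    · exact .inl ha
    · refine .inr fun u w h => ?_
      have : ¬ Cl v (fun y => ¬ InBox u w (v (y + a))) (v x) := fun hcl => ha ⟨u, w, h, hcl⟩
      unfold Cl at this
      push Not at this
      obtain ⟨p, q, hpq, hy⟩ := this
      obtain ⟨y, hyB, hyb⟩ := hx p q hpq
      refine ⟨y + a, by simpa using hyB, ?_⟩
      by_contra hc
      exact hy y hc hyb

/-- The coordinate projections of the cosets of all definable subgroups of finite index are
locally constant to the right, outside of a common finite set. -/
theorem OMinimal.coset_right_const [Infinite Γ] (hM : OMinimal L M) (hv : DMap L M v)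
    (hinj : Function.Injective v) (hthin : Thin v) (j : Fin k) :
    ∃ Z : Set M, Z.Finite ∧ ∀ B : AddSubgroup Γ, Dp L M (· ∈ B) → B.FiniteIndex →
      ∀ x, ∀ t ∉ Z, ∃ u > t, ∀ z, t < z → z < u →
        ((∃ y, y - x ∈ B ∧ v y j = z) ↔ ∃ y, y - x ∈ B ∧ v y j = t) := by
  have := hM.1
  have := hM.2.1
  have := hM.2.2.1
  obtain ⟨X₀, hX₀, hbd⟩ := hM.exists_finite_boundary hv hinj hthin
  refine ⟨{t | ∃ x, v x j = t ∧ ¬ Cl v (fun y => v x j < v y j) (v x)} ∪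
    (⋃ l, {t | ∀ b p q, p < t → t < q → ∃ x, p < v x j ∧ v x j < q ∧ b < v x l}) ∪
    (⋃ l, {t | ∀ b p q, p < t → t < q → ∃ x, p < v x j ∧ v x j < q ∧ v x l < b}) ∪
    {t | ∃ x : Fin k → M, (∀ y, v y ≠ x) ∧ x j = t ∧ Cl v (fun _ => True) x} ∪
    (fun x => v x j) '' X₀ ∪ {t | {x | v x j = t}.Infinite},
    (((((hM.finite_not_cl_gt hv hthin j).union
      (Set.finite_iUnion fun l => hM.finite_unbounded hv hthin j l)).union
      (Set.finite_iUnion fun l => hM.finite_unbounded_below hv hthin j l)).union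
      (hM.finite_frontier_range hv hthin j)).union (hX₀.image _)).union (hthin j),
    fun B hB hfin x t ht => ?_⟩
  simp only [Set.mem_union, not_or] at ht
  obtain ⟨⟨⟨⟨⟨hgt, hub⟩, hlb⟩, hfr⟩, hX⟩, hthint⟩ := ht
  simp only [Set.mem_iUnion, Set.mem_ofPred_eq, not_exists] at hub hlb
  push Not at hub hlb
  have hC : Dp L M fun y => y - x ∈ B := hB.comp (f := fun y => y - x) (by fun_prop)
  have hT : Dp L M fun z => ∃ y, y - x ∈ B ∧ v y j = z := by
    refine .ex (.and (hC.comp ?_) (.eq ?_ ?_)) <;> fun_prop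
  rcases hM.right_germ hT t with ⟨u, hu, h⟩ | ⟨u, hu, h⟩
  · refine ⟨u, hu, fun z hz hz' => iff_of_true (h z hz hz') ?_⟩
    obtain ⟨u', hu', hfib⟩ := exists_gt_le_of_finite (hthin j) t
    obtain ⟨S, hS, hSC, hSI, huniq⟩ := hM.exists_section hv hinj hC j (I := Set.Ioo t (min u u'))
      (fun s hs => Set.not_infinite.1 fun hc =>
        absurd (hfib s hc hs.1) (not_le.2 (lt_min_iff.1 hs.2).2))
      fun s hs => h s hs.1 (lt_min_iff.1 hs.2).1
    obtain ⟨z', hz'j, hcl⟩ := hM.exists_right_limit hv hS huniq (t := t)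
      (fun w hw => by
        obtain ⟨s, hts, hs⟩ := exists_between (lt_min hw (lt_min hu hu'))
        rw [lt_min_iff] at hs
        obtain ⟨y, hy, rfl⟩ := hSI s ⟨hts, hs.2⟩
        exact ⟨y, hy, hts, hs.1⟩)
      (fun l => by
        obtain ⟨b, p, q, hp, hq, h⟩ := hub l
        exact ⟨b, q, hq, fun x _ h₁ h₂ => h x (hp.trans h₁) h₂⟩)
      (fun l => by
        obtain ⟨b, p, q, hp, hq, h⟩ := hlb l
        exact ⟨b, q, hq, fun x _ h₁ h₂ => h x (hp.trans h₁) h₂⟩)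
    by_cases hr : ∀ y, v y ≠ z'
    · refine absurd ⟨z', hr, hz'j, fun p q hpq => ?_⟩ hfr
      obtain ⟨y, -, hy⟩ := hcl p q hpq
      exact ⟨y, trivial, hy⟩
    · push Not at hr
      obtain ⟨y, rfl⟩ := hr
      refine ⟨y, ?_, hz'j⟩
      by_contra hy
      refine hX ⟨y, hbd B hB hfin y fun p q hpq => ?_, hz'j⟩
      obtain ⟨y', hy', hb⟩ := hcl p q hpq
      refine ⟨y', fun hc => hy ?_, hb⟩
      simpa using B.sub_mem (hSC y' hy') hc
  · refine ⟨u, hu, fun z hz hz' => iff_of_false (h z hz hz') ?_⟩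
    rintro ⟨y, hy, rfl⟩
    have hcl : Cl v (fun z => v y j < v z j) (v y) := by
      by_contra hc
      exact hgt ⟨y, rfl, hc⟩
    have hnb : ¬ Cl v (fun z => z - y ∉ B) (v y) := fun hc => hX ⟨y, hbd B hB hfin y hc, rfl⟩
    unfold Cl at hnb
    push Not at hnb
    obtain ⟨p, q, hpq, hbox⟩ := hnb
    obtain ⟨y', hlt, hy'⟩ := hcl p (Function.update q j (min (q j) u)) fun i => by
      rcases eq_or_ne i j with rfl | hi
      · simpa using ⟨(hpq i).1, (hpq i).2, hu⟩
      · simpa [hi] using hpq i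
    have hj := hy' j
    simp only [Function.update_self, lt_min_iff] at hj
    refine h _ hlt hj.2.2 ⟨y', ?_, rfl⟩
    by_contra hc
    refine hbox y' (fun hc' => hc (by simpa using B.add_mem hc' hy)) fun i => ?_
    rcases eq_or_ne i j with rfl | hi
    · exact ⟨hj.1, hj.2.1⟩
    · simpa [hi] using hy' i

end Cosets

section Simplicity

variable {L : FirstOrder.Language} {M : Type} [L.Structure M] [LinearOrder M]
  {Γ : Type} [DSp L M Γ] [AddCommGroup Γ] [DefAdd L M Γ] {k : ℕ} {v : Γ → Fin k → M}

/-- The coordinate projections of the cosets of all definable subgroups of finite index are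
locally constant to the left, outside of a common finite set. -/
lemma OMinimal.coset_left_const [Infinite Γ] (hM : OMinimal L M) (hv : DMap L M v)
    (hinj : Function.Injective v) (hthin : Thin v) (j : Fin k) :
    ∃ Z : Set M, Z.Finite ∧ ∀ B : AddSubgroup Γ, Dp L M (· ∈ B) → B.FiniteIndex →
      ∀ x, ∀ t ∉ Z, ∃ u < t, ∀ z, u < z → z < t →
        ((∃ y, y - x ∈ B ∧ v y j = z) ↔ ∃ y, y - x ∈ B ∧ v y j = t) := by
  obtain ⟨Z, hZ, h⟩ :=
    @OMinimal.coset_right_const L M _ Γ _ _ k v _ (dualOrder M) _ hM.dual hv hinj hthin j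
  refine ⟨Z, hZ, fun B hB hfin x t ht => ?_⟩
  obtain ⟨u, hu, h'⟩ := h B hB hfin x t ht
  exact ⟨u, hu, fun z hz hz' => h' z hz' hz⟩

/-- A finite set of sample points meeting every definable set that is locally constant and nonempty
outside of a given finite set. -/
lemma OMinimal.exists_sample (hM : OMinimal L M) {Z : Set M} (hZ : Z.Finite) :
    ∃ P : Set M, P.Finite ∧ P ⊆ Zᶜ ∧ ∀ s : M → Prop, Dp L M s →
      (∀ t ∉ Z, ∃ u > t, ∀ z, t < z → z < u → (s z ↔ s t)) →
      (∀ t ∉ Z, ∃ u < t, ∀ z, u < z → z < t → (s z ↔ s t)) → ∀ t ∉ Z, s t → ∃ p ∈ P, s p := by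
  set cut : M → Set M := fun t => {z ∈ Z | z < t}
  obtain ⟨P, hPZ, hP⟩ := Set.exists_subset_bijOn Zᶜ cut
  refine ⟨P, ?_, hPZ, fun s hs hr hl t ht hst => ?_⟩
  · refine Set.Finite.of_finite_image (f := cut) (hZ.finite_subsets.subset ?_) hP.injOn
    rintro _ ⟨t, -, rfl⟩
    exact Set.sep_subset _ _
  obtain ⟨p, hp, hpt⟩ := hP.surjOn ⟨t, ht, rfl⟩
  refine ⟨p, hp, ?_⟩
  have key : ∀ x y, x ∉ Z → cut x = cut y → ∀ r, x ≤ r → r < y → r ∉ Z := by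
    intro x y hx hxy r hxr hry hr
    have h₁ : r ∈ cut y := ⟨hr, hry⟩
    rw [← hxy] at h₁
    exact absurd h₁.2 (not_lt.2 hxr)
  have key' : ∀ x y, x ∉ Z → y ∉ Z → cut x = cut y → ∀ r, x ≤ r → r ≤ y → r ∉ Z := by
    intro x y hx hy hxy r hxr hry
    rcases hry.lt_or_eq with h | rfl
    · exact key x y hx hxy r hxr h
    · exact hy
  rcases le_total t p with htp | hpt'
  · have hk := key' t p ht (hPZ hp) hpt.symm
    exact hM.imp_of_locally_const hs htp (fun r h₁ h₂ => hr r (hk r h₁ h₂.le))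
      (fun r h₁ h₂ => hl r (hk r h₁.le h₂)) hst
  · have hk := key' p t (hPZ hp) ht hpt
    by_contra hc
    refine hM.imp_of_locally_const hs.not hpt' (fun r h₁ h₂ => ?_) (fun r h₁ h₂ => ?_) hc hst
    · obtain ⟨u, hu, h⟩ := hr r (hk r h₁ h₂.le)
      exact ⟨u, hu, fun z hz hz' => not_congr (h z hz hz')⟩
    · obtain ⟨u, hu, h⟩ := hl r (hk r h₁.le h₂)
      exact ⟨u, hu, fun z hz hz' => not_congr (h z hz hz')⟩

/-- The definable subgroups of finite index of a definable thin abelian group have bounded index. -/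
theorem OMinimal.exists_index_le [Infinite Γ] (hM : OMinimal L M) (hv : DMap L M v)
    (hinj : Function.Injective v) (hthin : Thin v) :
    ∃ N : ℕ, ∀ B : AddSubgroup Γ, Dp L M (· ∈ B) → B.FiniteIndex → B.index ≤ N := by
  choose Z₁ hZ₁ h₁ using fun j => hM.coset_right_const hv hinj hthin j
  choose Z₂ hZ₂ h₂ using fun j => hM.coset_left_const hv hinj hthin j
  set Z : Fin k → Set M := fun j => Z₁ j ∪ Z₂ j ∪ {t | {x | v x j = t}.Infinite}
  have hZ : ∀ j, (Z j).Finite := fun j => ((hZ₁ j).union (hZ₂ j)).union (hthin j)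
  choose P hP hPZ hsamp using fun j => hM.exists_sample (hZ j)
  have hK : (⋃ j, {x | v x j ∈ P j}).Finite := by
    refine Set.finite_iUnion fun j => ((hP j).biUnion (t := fun p => {x | v x j = p})
      fun p hp => ?_).subset fun x hx => Set.mem_biUnion (x := v x j) hx rfl
    exact Set.not_infinite.1 fun h => hPZ j hp (.inr h)
  have := hK.to_subtype
  refine ⟨Nat.card (⋃ j, {x | v x j ∈ P j}), fun B hB hfin => ?_⟩
  refine Nat.card_le_card_of_surjective
    (fun x : ⋃ j, {x | v x j ∈ P j} => (x.1 : Γ ⧸ B)) fun q => ?_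
  obtain ⟨x, rfl⟩ := QuotientAddGroup.mk_surjective q
  have hC : Dp L M fun y => y - x ∈ B := hB.comp (f := fun y => y - x) (by fun_prop)
  have hinf : {y | y - x ∈ B}.Infinite := by
    intro h
    refine Set.infinite_univ (α := Γ) ((Set.finite_iUnion (ι := Γ ⧸ B)
      (f := fun q => {y | y - q.out ∈ B}) fun q => ?_).subset fun y _ => Set.mem_iUnion.2
        ⟨(y : Γ ⧸ B), ?_⟩)
    · refine (h.image fun y => y - x + q.out).subset fun y hy => ⟨y - q.out + x, ?_, ?_⟩
      swap
      · exact show y - q.out + x - x + q.out = y by abel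
      simpa using hy
    · rw [Set.mem_ofPred_eq, ← QuotientAddGroup.eq_zero_iff, QuotientAddGroup.mk_sub,
        QuotientAddGroup.out_eq', sub_self]
  obtain ⟨j, hj⟩ := exists_infinite_image_coord hinj hinf
  obtain ⟨_, ⟨y, hy, rfl⟩, hyZ⟩ := (hj.sdiff (hZ j)).nonempty
  obtain ⟨p, hp, y', hy', rfl⟩ := hsamp j (fun z => ∃ y, y - x ∈ B ∧ v y j = z)
    (by refine .ex (.and (hC.comp ?_) (.eq ?_ ?_)) <;> fun_prop)
    (fun t ht => h₁ j B hB hfin x t fun h => ht (.inl (.inl h)))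
    (fun t ht => h₂ j B hB hfin x t fun h => ht (.inl (.inr h))) _ hyZ ⟨y, hy, rfl⟩
  refine ⟨⟨y', Set.mem_iUnion.2 ⟨j, hp⟩⟩, ?_⟩
  rw [← sub_eq_zero, ← QuotientAddGroup.mk_sub, QuotientAddGroup.eq_zero_iff]
  exact hy'

omit [DSp L M Γ] [DefAdd L M Γ] [L.Structure M] [LinearOrder M] in
lemma infinite_of_torsionFree (htf : ∀ (n : ℕ) (x : Γ), n ≠ 0 → n • x = 0 → x = 0)
    {B : AddSubgroup Γ} (hne : B ≠ ⊥) : {x | x ∈ B}.Infinite := by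
  obtain ⟨b, hb, hb₀⟩ := B.bot_or_exists_ne_zero.resolve_left hne
  refine Set.infinite_of_injective_forall_mem (f := fun n : ℕ => n • b) (fun m n hmn => ?_)
    fun n => B.nsmul_mem hb n
  wlog hlt : m < n generalizing m n
  · rcases (not_lt.1 hlt).eq_or_lt with h | h
    · exact h.symm
    · exact (this n m hmn.symm h).symm
  refine absurd (htf (n - m) b (by omega) ?_) hb₀
  obtain ⟨d, rfl⟩ := Nat.exists_eq_add_of_lt hlt
  rw [show m + d + 1 - m = d + 1 by omega]
  have : m • b = (m + d + 1) • b := hmn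
  rw [add_assoc, add_smul] at this
  simpa using this

/-- A nonzero definable subgroup of a torsion-free definable thin abelian group has finite index. -/
lemma OMinimal.finiteIndex_of_ne_bot (hM : OMinimal L M) (hv : DMap L M v)
    (hinj : Function.Injective v) (hthin : Thin v)
    (htf : ∀ (n : ℕ) (x : Γ), n ≠ 0 → n • x = 0 → x = 0) {B : AddSubgroup Γ}
    (hB : Dp L M (· ∈ B)) (hne : B ≠ ⊥) : B.FiniteIndex := by
  have hBinf := infinite_of_torsionFree htf hne
  have hrel : Dp L M fun p : Γ × Γ => (p.1 : Γ ⧸ B) = p.2 := by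
    simp only [QuotientAddGroup.eq]
    exact hB.comp (f := fun p : Γ × Γ => -p.1 + p.2) (by fun_prop)
  let := DSp.ofSurjective QuotientAddGroup.mk_surjective hrel
  have hmk : DMap L M fun x : Γ => (x : Γ ⧸ B) :=
    DMap.ofSurjective QuotientAddGroup.mk_surjective hrel
  have : Finite (Γ ⧸ B) := by
    by_contra hinf
    rw [not_finite_iff_infinite] at hinf
    obtain ⟨y, hy⟩ := hM.exists_infinite_fibre hv hinj hthin
      (R := fun (q : Γ ⧸ B) (y : Γ) => (y : Γ ⧸ B) = q) (.eq (by fun_prop) (by fun_prop)) (by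
        refine Set.infinite_univ.mono fun q _ => ?_
        obtain ⟨x, rfl⟩ := QuotientAddGroup.mk_surjective q
        refine Set.Infinite.mono ?_ (hBinf.image (f := (x + ·)) (add_right_injective x).injOn)
        rintro _ ⟨b, hb, rfl⟩
        exact QuotientAddGroup.mk_add_of_mem x hb)
    exact hy (Set.toFinite {(y : Γ ⧸ B)} |>.subset fun q hq => Eq.symm hq)
  exact AddSubgroup.finiteIndex_of_finite_quotient

/-- A torsion-free definable thin abelian group has no proper nonzero definable subgroups. -/
theorem OMinimal.eq_top_of_ne_bot (hM : OMinimal L M) (hv : DMap L M v)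
    (hinj : Function.Injective v) (hthin : Thin v)
    (htf : ∀ (n : ℕ) (x : Γ), n ≠ 0 → n • x = 0 → x = 0) {B : AddSubgroup Γ}
    (hB : Dp L M (· ∈ B)) (hne : B ≠ ⊥) : B = ⊤ := by
  have : Infinite Γ := by
    have := (infinite_of_torsionFree htf hne).to_subtype
    exact Infinite.of_injective (Subtype.val : {x | x ∈ B} → Γ) Subtype.val_injective
  have hfin := hM.finiteIndex_of_ne_bot hv hinj hthin htf hB hne
  obtain ⟨N, hN⟩ := hM.exists_index_le hv hinj hthin
  set I := AddSubgroup.index '' {C : AddSubgroup Γ | Dp L M (· ∈ C) ∧ C.FiniteIndex}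
  have hI : BddAbove I := ⟨N, by rintro _ ⟨C, hC, rfl⟩; exact hN C hC.1 hC.2⟩
  obtain ⟨B₀, ⟨hB₀, hfin₀⟩, hmax⟩ := Nat.sSup_mem (s := I) ⟨_, B, ⟨hB, hfin⟩, rfl⟩ hI
  have hle : ∀ C : AddSubgroup Γ, Dp L M (· ∈ C) → C.FiniteIndex → B₀ ≤ C := fun C hC hfinC => by
    have h : (B₀ ⊓ C).index ≤ B₀.index := hmax ▸ le_csSup hI
      ⟨B₀ ⊓ C, ⟨by simpa only [AddSubgroup.mem_inf] using hB₀.and hC, inferInstance⟩, rfl⟩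
    by_contra hC
    exact absurd h (not_le.2 (AddSubgroup.index_strictAnti (inf_lt_left.2 hC)))
  have hm := hfin₀.index_ne_zero
  set m := B₀.index
  have hB₀ne : B₀ ≠ ⊥ := by
    rintro rfl
    exact hm (AddSubgroup.index_bot.trans Nat.card_eq_zero_of_infinite)
  have hmap : B₀ ≤ B₀.map (nsmulAddMonoidHom m) := by
    have hdef : Dp L M (· ∈ B₀.map (nsmulAddMonoidHom m)) := by
      simp only [AddSubgroup.mem_map, nsmulAddMonoidHom_apply]
      have : DMap L M fun x : Γ => m • x := by
        induction m with
        | zero => simpa using DMap.const _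
        | succ m ih => simpa only [succ_nsmul] using ih.add .id
      exact .ex (.and (hB₀.comp (by fun_prop)) (.eq (by fun_prop) (by fun_prop)))
    refine hle _ hdef (hM.finiteIndex_of_ne_bot hv hinj hthin htf hdef fun h => hB₀ne ?_)
    rw [eq_bot_iff]
    intro x hx
    have : m • x ∈ B₀.map (nsmulAddMonoidHom m) := ⟨x, hx, rfl⟩
    rw [h, AddSubgroup.mem_bot] at this
    exact htf m x hm this
  refine eq_top_iff.2 (le_trans (fun x _ => ?_) (hle B hB hfin))
  obtain ⟨b, hb, hbx⟩ := hmap (B₀.nsmul_index_mem x)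
  have : m • (x - b) = 0 := by
    rw [nsmul_sub, sub_eq_zero]
    exact hbx.symm
  rwa [← sub_eq_zero.1 (htf m _ hm this)] at hb

end Simplicity

section Dimension

variable {L : FirstOrder.Language} {M : Type} [L.Structure M] [LinearOrder M] {k : ℕ}

omit [L.Structure M] in
lemma interior_nonempty_iff_exists_box [DenselyOrdered M] [NoMinOrder M] [NoMaxOrder M] {n : ℕ}
    {S : Set (Fin n → M)} : (@interior _ (ptop M n) S).Nonempty ↔
      ∃ a b : Fin n → M, (∀ i, a i < b i) ∧ ∀ z, (∀ i, a i < z i ∧ z i < b i) → z ∈ S := by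
  let : TopologicalSpace M := otop M
  have : OrderTopology M := ⟨rfl⟩
  have hp : ptop M n = Pi.topologicalSpace := rfl
  rw [hp]
  constructor
  · rintro ⟨x, hx⟩
    obtain ⟨I, u, hu, hsub⟩ := isOpen_pi_iff.1 isOpen_interior x hx
    have : ∀ i, ∃ a b, (a < x i ∧ x i < b) ∧ (i ∈ I → Set.Ioo a b ⊆ u i) := fun i => by
      by_cases hi : i ∈ I
      · obtain ⟨a, b, hab, h⟩ := mem_nhds_iff_exists_Ioo_subset.1 ((hu i hi).1.mem_nhds (hu i hi).2)
        exact ⟨a, b, hab, fun _ => h⟩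
      · obtain ⟨a, ha⟩ := exists_lt (x i)
        obtain ⟨b, hb⟩ := exists_gt (x i)
        exact ⟨a, b, ⟨ha, hb⟩, fun h => absurd h hi⟩
    choose a b hab h using this
    exact ⟨a, b, fun i => (hab i).1.trans (hab i).2, fun z hz =>
      interior_subset (hsub fun i hi => h i hi (hz i))⟩
  · rintro ⟨a, b, hab, h⟩
    choose z hz using fun i => exists_between (hab i)
    exact ⟨z, mem_interior.2 ⟨Set.univ.pi fun i => Set.Ioo (a i) (b i),
      fun y hy => h y fun i => hy i trivial,
      isOpen_set_pi Set.finite_univ fun i _ => isOpen_Ioo, fun i _ => hz i⟩⟩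

/-- A definable set has dimension one iff it is infinite and all but finitely many fibres of each
coordinate are finite. -/
theorem OMinimal.dimEq_one_iff (hM : OMinimal L M) {X : Set (Fin k → M)} (hX : Dp L M (· ∈ X)) :
    DimEq M X 1 ↔ X.Infinite ∧ ∀ j, {t | {x | x ∈ X ∧ x j = t}.Infinite}.Finite := by
  have := hM.1
  have := hM.2.1
  have := hM.2.2.1
  unfold DimEq DimGE
  simp only [interior_nonempty_iff_exists_box]
  constructor
  · rintro ⟨⟨f, -, a, b, hab, h⟩, hmax⟩
    refine ⟨fun hfin => (Set.Ioo_infinite (hab 0)) ((hfin.image fun x => x (f 0)).subset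
      fun t ht => ?_), fun j => ?_⟩
    · obtain ⟨x, hx, hxt⟩ := h (fun _ => t) fun i => by rwa [Subsingleton.elim i 0]
      exact ⟨x, hx, congrFun hxt 0⟩
    · by_contra hinf
      obtain ⟨l, hl⟩ : ∃ l, {t | {z | ∃ x, x ∈ X ∧ x j = t ∧ x l = z}.Infinite}.Infinite := by
        by_contra! hfin
        refine hinf ((Set.finite_iUnion hfin).subset fun t ht => ?_)
        obtain ⟨l, hl⟩ := exists_infinite_image_coord Function.injective_id ht
        refine Set.mem_iUnion.2 ⟨l, hl.mono ?_⟩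
        rintro _ ⟨x, ⟨hx, hxt⟩, rfl⟩
        exact ⟨x, hx, hxt, rfl⟩
      obtain ⟨p, q, u, w, hpq, huw, hbox⟩ := hM.exists_planar_box
        (D := fun t z => ∃ x, x ∈ X ∧ x j = t ∧ x l = z) (by
          refine .ex (.and (hX.comp (f := fun p : (M × M) × (Fin k → M) => p.2) ?_)
            (.and (.eq ?_ ?_) (.eq ?_ ?_))) <;> fun_prop) hl
      refine absurd (hmax 2 ⟨![j, l], ?_, ![p, u], ![q, w], ?_, fun z hz => ?_⟩) (by norm_num)
      · have hjl : j ≠ l := by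
          rintro rfl
          obtain ⟨t, hpt, htq⟩ := exists_between hpq
          obtain ⟨z, huz, hzw⟩ := exists_between huw
          obtain ⟨z', hzz', hzw'⟩ := exists_between hzw
          obtain ⟨x, -, h₁, h₂⟩ := hbox t z hpt htq huz hzw
          obtain ⟨y, -, h₃, h₄⟩ := hbox t z' hpt htq (huz.trans hzz') hzw'
          exact hzz'.ne (h₂.symm.trans (h₁.trans (h₃.symm.trans h₄)))
        intro i i'
        fin_cases i <;> fin_cases i' <;> simp [hjl, hjl.symm]
      · simp [Fin.forall_fin_two, hpq, huw]
      · simp only [Fin.forall_fin_two] at hz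
        obtain ⟨x, hx, h₁, h₂⟩ := hbox (z 0) (z 1) hz.1.1 hz.1.2 hz.2.1 hz.2.2
        refine ⟨x, hx, funext fun i => ?_⟩
        fin_cases i <;> assumption
  · rintro ⟨hinf, hthin⟩
    constructor
    · obtain ⟨j, hj⟩ := exists_infinite_image_coord Function.injective_id hinf
      obtain ⟨u, w, huw, h⟩ := hM.exists_interval (s := fun t => ∃ x, x ∈ X ∧ x j = t) (by
        refine .ex (.and (hX.comp (f := fun p : M × (Fin k → M) => p.2) ?_) (.eq ?_ ?_))
          <;> fun_prop) hj
      refine ⟨fun _ => j, Function.injective_of_subsingleton _, fun _ => u, fun _ => w,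
        fun _ => huw, fun z hz => ?_⟩
      obtain ⟨x, hx, hxz⟩ := h (z 0) (hz 0).1 (hz 0).2
      exact ⟨x, hx, funext fun i => by rw [Subsingleton.elim i 0]; exact hxz⟩
    · rintro m ⟨f, -, a, b, hab, h⟩
      by_contra! hm
      let i₀ : Fin m := ⟨0, by omega⟩
      let i₁ : Fin m := ⟨1, hm⟩
      choose z hz using fun i => exists_between (hab i)
      refine Set.Infinite.mono (fun t ht hfin => ?_) (Set.Ioo_infinite (hab i₀)) (hthin (f i₀))
      refine (Set.Ioo_infinite (hab i₁)) ((hfin.image fun x => x (f i₁)).subset fun s hs => ?_)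
      have hne : i₁ ≠ i₀ := by simp [i₀, i₁]
      obtain ⟨x, hx, hxz⟩ := h (Function.update (Function.update z i₁ s) i₀ t) fun i => by
        rcases eq_or_ne i i₀ with rfl | hi
        · simpa using ht
        · rcases eq_or_ne i i₁ with rfl | hi'
          · simpa [hi] using hs
          · simpa [hi, hi'] using hz i
      refine ⟨x, ⟨hx, ?_⟩, ?_⟩
      · simpa using congrFun hxz i₀
      · simpa [hne] using congrFun hxz i₁

end Dimension

section Splitting

variable {L : FirstOrder.Language} {M : Type} [L.Structure M]
  {Γ ι κ : Type} [AddCommGroup Γ] {k : ℕ} {v : Γ → Fin k → M}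

/-- `S` is the internal direct sum of the subgroups `B i`. -/
structure IsDirect [Fintype ι] (B : ι → AddSubgroup Γ) (S : AddSubgroup Γ) : Prop where
  le : ∀ i, B i ≤ S
  exists_sum : ∀ x ∈ S, ∃ f : ι → Γ, (∀ i, f i ∈ B i) ∧ ∑ i, f i = x
  eq_zero : ∀ f : ι → Γ, (∀ i, f i ∈ B i) → ∑ i, f i = 0 → ∀ i, f i = 0

lemma mem_finset_sup [Fintype ι] [DecidableEq ι] {A : ι → AddSubgroup Γ} {I : Finset ι} {x : Γ} :
    x ∈ I.sup A ↔ ∃ f : ι → Γ, (∀ i, f i ∈ A i) ∧ (∀ i ∉ I, f i = 0) ∧ ∑ i, f i = x := by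
  constructor
  · induction I using Finset.induction_on generalizing x with
    | empty =>
      intro hx
      exact ⟨0, fun i => (A i).zero_mem, fun _ _ => rfl, by simpa [eq_comm] using hx⟩
    | insert s I hs ih =>
      rw [Finset.sup_insert, AddSubgroup.mem_sup]
      rintro ⟨a, ha, t, ht, rfl⟩
      obtain ⟨f, hf, hfI, rfl⟩ := ih ht
      refine ⟨fun i => Pi.single (M := fun _ => Γ) s a i + f i, fun i => ?_, fun i hi => ?_, ?_⟩
      · refine (A i).add_mem ?_ (hf i)
        rcases eq_or_ne i s with rfl | h
        · simpa using ha
        · simp [h]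
      · rw [Finset.mem_insert, not_or] at hi
        simp [hi.1, hfI i hi.2]
      · rw [Finset.sum_add_distrib, Finset.sum_pi_single']
        simp
  · rintro ⟨f, hf, hfI, rfl⟩
    refine sum_mem fun i _ => ?_
    by_cases hi : i ∈ I
    · exact Finset.le_sup (f := A) hi (hf i)
    · rw [hfI i hi]
      exact zero_mem _

lemma IsDirect.inf_finset_sup [Fintype ι] [DecidableEq ι] {A : ι → AddSubgroup Γ}
    {S : AddSubgroup Γ} (hA : IsDirect A S) {I : Finset ι} {s : ι} (hs : s ∉ I) :
    A s ⊓ I.sup A = ⊥ := by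
  refine eq_bot_iff.2 fun x hx => ?_
  obtain ⟨hxs, hxI⟩ := AddSubgroup.mem_inf.1 hx
  obtain ⟨f, hf, hfI, hsum⟩ := mem_finset_sup.1 hxI
  have := hA.eq_zero (fun i => f i - Pi.single (M := fun _ => Γ) s x i) (fun i => by
    refine (A i).sub_mem (hf i) ?_
    rcases eq_or_ne i s with rfl | h
    · simpa using hxs
    · simp [h]) (by
    rw [Finset.sum_sub_distrib, hsum, Finset.sum_pi_single']
    simp) s
  simpa [hfI s hs] using this

lemma sum_extend [Fintype ι] [Fintype κ] {e : κ → ι} (he : Function.Injective e) (f : κ → Γ) :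
    ∑ i, Function.extend e f 0 i = ∑ j, f j := by
  refine (Finset.sum_of_injOn e he.injOn (fun _ _ => Finset.mem_coe.2 (Finset.mem_univ _))
    (fun i _ hi => ?_) fun j _ => (he.extend_apply f 0 j).symm).symm
  rw [Function.extend_apply' _ _ _ fun h => hi (by simpa using h), Pi.zero_apply]

lemma extend_mem {A : ι → AddSubgroup Γ} {e : κ → ι} (he : Function.Injective e) {f : κ → Γ}
    (hf : ∀ j, f j ∈ A (e j)) (i : ι) : Function.extend e f 0 i ∈ A i := by
  by_cases hi : ∃ j, e j = i
  · obtain ⟨j, rfl⟩ := hi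
    rw [he.extend_apply]
    exact hf j
  · rw [Function.extend_apply' _ _ _ hi]
    exact zero_mem _

/-- A subgroup independent of the summands indexed by `I` and generating the group with them is
a complement of their sum. -/
lemma IsDirect.cons [Fintype ι] [DecidableEq ι] {A : ι → AddSubgroup Γ} (hA : IsDirect A ⊤)
    {H : AddSubgroup Γ} {I : Finset ι} {m : ℕ} {e : Fin m → ι} (he : Function.Injective e)
    (heI : ∀ i, i ∈ I ↔ i ∈ Set.range e) (hbot : H ⊓ I.sup A = ⊥)
    (htop : ∀ i, A i ≤ H ⊔ I.sup A) :
    IsDirect (Fin.cons H fun j => A (e j) : Fin (m + 1) → AddSubgroup Γ) ⊤ where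
  le _ := le_top
  exists_sum x hx := by
    obtain ⟨f, hf, rfl⟩ := hA.exists_sum x hx
    obtain ⟨h, hh, t, ht, hsum⟩ := AddSubgroup.mem_sup.1
      (sum_mem fun i (_ : i ∈ Finset.univ) => htop i (hf i))
    obtain ⟨g, hg, hgI, rfl⟩ := mem_finset_sup.1 ht
    refine ⟨Fin.cons h fun j => g (e j), Fin.forall_fin_succ.2 ⟨hh, fun j => hg _⟩, ?_⟩
    rw [← hsum, Fin.sum_univ_succ, Fin.cons_zero]
    simp only [Fin.cons_succ]
    rw [← sum_extend he]
    congr 1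
    refine Finset.sum_congr rfl fun i _ => ?_
    by_cases hi : ∃ j, e j = i
    · obtain ⟨j, rfl⟩ := hi
      exact he.extend_apply _ _ _
    · rw [Function.extend_apply' _ _ _ hi, hgI i fun h => hi ((heI i).1 h), Pi.zero_apply]
  eq_zero f hf hsum := by
    rw [Fin.forall_fin_succ] at hf ⊢
    simp only [Fin.cons_zero, Fin.cons_succ] at hf
    rw [Fin.sum_univ_succ, ← sum_extend he] at hsum
    have hT : ∑ i, Function.extend e (fun j => f j.succ) 0 i ∈ I.sup A :=
      mem_finset_sup.2 ⟨_, extend_mem he hf.2, fun i hi =>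
        Function.extend_apply' _ _ _ fun h => hi ((heI i).2 h), rfl⟩
    have h0 : f 0 = 0 := by
      rw [← AddSubgroup.mem_bot, ← hbot]
      refine ⟨hf.1, ?_⟩
      rw [eq_neg_of_add_eq_zero_left hsum]
      exact (I.sup A).neg_mem hT
    rw [h0, zero_add] at hsum
    refine ⟨h0, fun j => ?_⟩
    rw [← he.extend_apply (fun j => f j.succ) 0 j]
    exact hA.eq_zero _ (extend_mem he hf.2) hsum _

/-- The subgroup complementing the sum of the summands indexed by `I` is the direct sum of its
intersections with the sums of this one and one further summand. -/
lemma IsDirect.inf_sup [Fintype ι] [DecidableEq ι] [Fintype κ] {A : ι → AddSubgroup Γ}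
    (hA : IsDirect A ⊤) {H : AddSubgroup Γ} {I : Finset ι} {e : κ → ι}
    (he : Function.Injective e) (heI : ∀ i, i ∉ I ↔ i ∈ Set.range e) (hbot : H ⊓ I.sup A = ⊥)
    (htop : ∀ i, A i ≤ H ⊔ I.sup A) : IsDirect (fun j => H ⊓ (I.sup A ⊔ A (e j))) H where
  le _ := inf_le_left
  exists_sum x hx := by
    obtain ⟨f, hf, hfx⟩ := hA.exists_sum x trivial
    choose h hh t ht hsum using fun j => AddSubgroup.mem_sup.1 (htop (e j) (hf (e j)))
    refine ⟨h, fun j => ⟨hh j, AddSubgroup.mem_sup.2 ⟨_, neg_mem (ht j), _, hf (e j), ?_⟩⟩, ?_⟩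
    · rw [← hsum j]
      abel
    · refine (sub_eq_zero.1 ?_).symm
      rw [← AddSubgroup.mem_bot, ← hbot]
      refine ⟨H.sub_mem hx (sum_mem fun j _ => hh j), ?_⟩
      have : x - ∑ j, h j = ∑ i, (f i - Function.extend e (fun j => f (e j)) 0 i) + ∑ j, t j := by
        rw [Finset.sum_sub_distrib, sum_extend he, ← hfx]
        simp only [← hsum, Finset.sum_add_distrib]
        abel
      rw [this]
      refine add_mem (mem_finset_sup.2 ⟨_, fun i => (A i).sub_mem (hf i)
        (extend_mem he (fun j => hf (e j)) i), fun i hi => ?_, rfl⟩) (sum_mem fun j _ => ht j)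
      obtain ⟨j, rfl⟩ := (heI i).1 hi
      rw [he.extend_apply, sub_self]
  eq_zero h hh hsum := by
    choose t ht a ha hta using fun j => AddSubgroup.mem_sup.1 (hh j).2
    obtain ⟨g, hg, hgI, hgt⟩ := mem_finset_sup.1 (sum_mem fun j (_ : j ∈ Finset.univ) => ht j)
    have h0 := hA.eq_zero (fun i => g i + Function.extend e a 0 i)
      (fun i => (A i).add_mem (hg i) (extend_mem he ha i)) (by
        rw [Finset.sum_add_distrib, sum_extend he, hgt, ← hsum, ← Finset.sum_add_distrib]
        exact Finset.sum_congr rfl fun j _ => hta j)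
    intro j
    rw [← AddSubgroup.mem_bot, ← hbot]
    refine ⟨(hh j).1, ?_⟩
    have : a j = 0 := by
      simpa [he.extend_apply, hgI _ ((heI _).2 ⟨j, rfl⟩)] using h0 (e j)
    rw [← hta j, this, add_zero]
    exact ht j

variable [DSp L M Γ] [DefAdd L M Γ]

lemma Dp.mem_sup {B C : AddSubgroup Γ} (hB : Dp L M (· ∈ B)) (hC : Dp L M (· ∈ C)) :
    Dp L M (· ∈ B ⊔ C) := by
  simp only [AddSubgroup.mem_sup]
  refine .ex (.and (hB.comp ?_) (.ex (.and (hC.comp ?_) (.eq ?_ ?_)))) <;> fun_prop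

omit [DefAdd L M Γ] in
lemma Dp.mem_inf {B C : AddSubgroup Γ} (hB : Dp L M (· ∈ B)) (hC : Dp L M (· ∈ C)) :
    Dp L M (· ∈ B ⊓ C) := by
  simpa only [AddSubgroup.mem_inf] using hB.and hC

lemma Dp.mem_finset_sup [DecidableEq ι] {A : ι → AddSubgroup Γ}
    (hA : ∀ i, Dp L M (· ∈ A i)) (I : Finset ι) : Dp L M (· ∈ I.sup A) := by
  induction I using Finset.induction_on with
  | empty =>
    simp only [Finset.sup_empty, AddSubgroup.mem_bot]
    exact .eq (by fun_prop) (by fun_prop)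
  | insert s I _ ih =>
    rw [Finset.sup_insert]
    exact (hA s).mem_sup ih

variable (L) in
omit [DefAdd L M Γ] in
/-- `B` is a definable subgroup of dimension one. -/
structure IsLine (v : Γ → Fin k → M) (B : AddSubgroup Γ) : Prop where
  dp : Dp L M (· ∈ B)
  infinite : {x | x ∈ B}.Infinite
  thin : ∀ j, {t | {x | x ∈ B ∧ v x j = t}.Infinite}.Finite

omit [DefAdd L M Γ] in
lemma IsLine.thin_comp {B : AddSubgroup Γ} (hB : IsLine L v B) : Thin fun x : B => v x := by
  refine fun j => (hB.thin j).subset fun t ht => ?_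
  refine Set.Infinite.mono ?_ (ht.image (f := Subtype.val) Subtype.val_injective.injOn)
  rintro _ ⟨x, hx, rfl⟩
  exact ⟨x.2, hx⟩

variable [LinearOrder M]

lemma OMinimal.le_or_inf_eq_bot (hM : OMinimal L M) (hv : DMap L M v)
    (hinj : Function.Injective v) (htf : ∀ (n : ℕ) (x : Γ), n ≠ 0 → n • x = 0 → x = 0)
    {A C : AddSubgroup Γ} (hA : IsLine L v A) (hC : Dp L M (· ∈ C)) : A ≤ C ∨ C ⊓ A = ⊥ := by
  let : DSp L M A := DSp.subtype hA.dp
  have hval : DMap L M fun x : A => (x : Γ) := DMap.subtype_val hA.dp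
  have : DefAdd L M A := ⟨DMap.of_subtype_val hA.dp
    ((hval.comp (.fst .id)).add (hval.comp (.snd .id)))⟩
  rw [← AddSubgroup.addSubgroupOf_eq_top, ← disjoint_iff, ← AddSubgroup.addSubgroupOf_eq_bot]
  by_cases h : C.addSubgroupOf A = ⊥
  · exact .inr h
  · refine .inl (hM.eq_top_of_ne_bot (v := fun x : A => v x) (hv.comp hval)
      (hinj.comp Subtype.val_injective) hA.thin_comp (fun n x hn hx => ?_) ?_ h)
    · exact Subtype.ext (htf n x hn (by simpa using congrArg Subtype.val hx))
    · simp only [AddSubgroup.mem_addSubgroupOf]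
      exact hC.comp hval

/-- Some of the lines `A i` form a complement of `H` together. -/
lemma OMinimal.exists_complement [Fintype ι] [DecidableEq ι] (hM : OMinimal L M) (hv : DMap L M v)
    (hinj : Function.Injective v) (htf : ∀ (n : ℕ) (x : Γ), n ≠ 0 → n • x = 0 → x = 0)
    {A : ι → AddSubgroup Γ} (hA : ∀ i, IsLine L v (A i)) {H : AddSubgroup Γ}
    (hH : Dp L M (· ∈ H)) :
    ∃ I : Finset ι, H ⊓ I.sup A = ⊥ ∧ ∀ i, A i ≤ H ⊔ I.sup A := by
  suffices h : ∀ J : Finset ι, ∃ I : Finset ι, H ⊓ I.sup A = ⊥ ∧ ∀ i ∈ J, A i ≤ H ⊔ I.sup A by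
    simpa using h Finset.univ
  intro J
  induction J using Finset.induction_on with
  | empty => exact ⟨∅, by simp⟩
  | insert s J _ ih =>
    obtain ⟨I, hbot, hI⟩ := ih
    rcases hM.le_or_inf_eq_bot hv hinj htf (hA s)
      (hH.mem_sup (.mem_finset_sup (fun i => (hA i).dp) I)) with h | h
    · exact ⟨I, hbot, by simpa [h] using hI⟩
    · refine ⟨insert s I, ?_, fun i hi => ?_⟩
      · rw [Finset.sup_insert, sup_comm]
        rw [← disjoint_iff] at hbot h ⊢
        exact hbot.disjoint_sup_right_of_disjoint_sup_left h
      · rw [Finset.sup_insert]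
        rcases Finset.mem_insert.1 hi with rfl | hi
        · exact le_sup_left.trans le_sup_right
        · exact (hI i hi).trans (sup_le_sup_left le_sup_right _)

lemma OMinimal.isLine_inf_sup (hM : OMinimal L M) (hv : DMap L M v) (hinj : Function.Injective v)
    {A H T : AddSubgroup Γ} (hA : IsLine L v A) (hH : Dp L M (· ∈ H)) (hT : Dp L M (· ∈ T))
    (hHT : H ⊓ T = ⊥) (hAT : A ⊓ T = ⊥) (hle : A ≤ H ⊔ T) : IsLine L v (H ⊓ (T ⊔ A)) where
  dp := hH.mem_inf (hT.mem_sup hA.dp)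
  infinite := by
    choose! h hh t ht hsum using fun x (hx : x ∈ A) => AddSubgroup.mem_sup.1 (hle hx)
    refine Set.infinite_of_injOn_mapsTo (f := h) (fun x hx y hy hxy => ?_) (fun x hx => ?_)
      hA.infinite
    · rw [← sub_eq_zero, ← AddSubgroup.mem_bot, ← hAT]
      refine ⟨A.sub_mem hx hy, ?_⟩
      rw [← hsum x hx, ← hsum y hy, hxy, add_sub_add_left_eq_sub]
      exact T.sub_mem (ht x hx) (ht y hy)
    · refine ⟨hh x hx, AddSubgroup.mem_sup.2 ⟨_, neg_mem (ht x hx), _, hx, ?_⟩⟩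
      nth_rw 2 [← hsum x hx]
      abel
  thin j := by
    by_contra hinf
    let : DSp L M A := DSp.subtype hA.dp
    have hval : DMap L M fun x : A => (x : Γ) := DMap.subtype_val hA.dp
    have heq : ∀ h ∈ H, ∀ h' ∈ H, ∀ y, h - y ∈ T → h' - y ∈ T → h = h' :=
      fun h hh h' hh' y hy hy' => by
        rw [← sub_eq_zero, ← AddSubgroup.mem_bot, ← hHT]
        exact ⟨H.sub_mem hh hh', by simpa using T.sub_mem hy hy'⟩
    obtain ⟨y, hy⟩ := hM.exists_infinite_fibre (v := fun x : A => v x) (hv.comp hval)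
      (hinj.comp Subtype.val_injective) hA.thin_comp
      (R := fun (t : M) (y : A) => ∃ h, h ∈ H ∧ v h j = t ∧ h - y ∈ T) (by
        refine .ex (.and (hH.comp ?_) (.and (.eq ?_ ?_) (hT.comp ?_)))
        · fun_prop
        · exact (DMap.apply j).comp (hv.comp (.snd .id))
        · fun_prop
        · exact DMap.sub (.snd .id) (hval.comp (.snd (.fst .id)))) (by
        refine Set.Infinite.mono (fun t ht => ?_) hinf
        choose! u hu y hy hsum using fun x (hx : x ∈ T ⊔ A) => AddSubgroup.mem_sup.1 hx
        have hsub : ∀ x ∈ T ⊔ A, x - y x ∈ T := fun x hx => by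
          rw [sub_eq_of_eq_add (hsum x hx).symm]
          exact hu x hx
        have : (y '' {x | x ∈ H ⊓ (T ⊔ A) ∧ v x j = t}).Infinite := by
          refine ht.image fun x hx x' hx' hxy => heq x hx.1.1 x' hx'.1.1 _ (hsub x hx.1.2) ?_
          rw [hxy]
          exact hsub x' hx'.1.2
        refine Set.Infinite.of_image Subtype.val (this.mono ?_)
        rintro _ ⟨x, hx, rfl⟩
        exact ⟨⟨y x, hy x hx.1.2⟩, ⟨x, hx.1.1, hx.2, hsub x hx.1.2⟩, rfl⟩)
    refine hy (Set.Subsingleton.finite ?_)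
    rintro t ⟨h, hh, rfl, hy⟩ t' ⟨h', hh', rfl, hy'⟩
    rw [heq h hh h' hh' y hy hy']

/-- In a torsion-free direct sum of definable lines, every definable subgroup is a direct sum of
definable lines and has a complement that is a direct sum of definable lines. -/
theorem OMinimal.exists_splitting (hM : OMinimal L M) (hv : DMap L M v)
    (hinj : Function.Injective v) (htf : ∀ (n : ℕ) (x : Γ), n ≠ 0 → n • x = 0 → x = 0) {n : ℕ}
    {A : Fin n → AddSubgroup Γ} (hA : ∀ i, IsLine L v (A i)) (hsum : IsDirect A ⊤)
    {H : AddSubgroup Γ} (hH : Dp L M (· ∈ H)) :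
    (∃ (s : ℕ) (B : Fin s → AddSubgroup Γ), (∀ i, IsLine L v (B i)) ∧ IsDirect B H) ∧
      ∃ (m : ℕ) (B : Fin m → AddSubgroup Γ), (∀ i, IsLine L v (B i)) ∧
        IsDirect (Fin.cons H B : Fin (m + 1) → AddSubgroup Γ) ⊤ := by
  obtain ⟨I, hbot, hI⟩ := hM.exists_complement hv hinj htf hA hH
  refine ⟨⟨_, _, fun j => ?_, hsum.inf_sup (e := Iᶜ.orderEmbOfFin rfl)
    (Iᶜ.orderEmbOfFin rfl).injective (by simp) hbot hI⟩, _, _, fun j => ?_,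
    hsum.cons (e := I.orderEmbOfFin rfl) (I.orderEmbOfFin rfl).injective (by simp) hbot hI⟩
  · exact hM.isLine_inf_sup hv hinj (hA _) hH (.mem_finset_sup (fun i => (hA i).dp) I) hbot
      (hsum.inf_finset_sup (Finset.mem_compl.1 (Iᶜ.orderEmbOfFin_mem rfl j))) (hI _)
  · exact hA _

end Splitting

section Groups

variable {L : FirstOrder.Language} {M : Type} [L.Structure M]

lemma dp_mem_iff {k : ℕ} {X : Set (Fin k → M)} : Dp L M (· ∈ X) ↔ Defin L M X := by
  refine iff_of_eq (congrArg (Defin L M) ?_)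
  ext a
  exact ⟨by rintro ⟨x, rfl, hx⟩; exact hx, fun h => ⟨a, rfl, h⟩⟩

namespace DefAbGroup

variable (G : DefAbGroup L M)

instance : AddCommGroup G.carrier :=
  let : Add G.carrier := ⟨fun x y => ⟨G.add x y, G.add_mem x x.2 y y.2⟩⟩
  let : Zero G.carrier := ⟨⟨G.zero, G.zero_mem⟩⟩
  let : Neg G.carrier := ⟨fun x => ⟨G.neg x, G.neg_mem x x.2⟩⟩
  { AddGroup.ofLeftAxioms
      (fun x y z : G.carrier => Subtype.ext (G.hadd_assoc x x.2 y y.2 z z.2))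
      (fun x => Subtype.ext (G.hzero_add x x.2)) fun x => Subtype.ext (G.hneg_add x x.2) with
    add_comm x y := Subtype.ext (G.hadd_comm x x.2 y y.2) }

instance : DSp L M G.carrier := DSp.subtype (dp_mem_iff.2 G.carrier_def)

lemma dmap_val : DMap L M (Subtype.val : G.carrier → Fin G.k → M) :=
  DMap.subtype_val (dp_mem_iff.2 G.carrier_def)

instance : DefAdd L M G.carrier where
  dmap_add := by
    refine (congrArg (Defin L M) ?_).mp (Set.Definable.preimage_comp
      (Sum.elim (Sum.inl ∘ Sum.inl) (Sum.elim (Sum.inl ∘ Sum.inr) Sum.inr)) G.add_def)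
    ext c
    constructor
    · rintro ⟨hx, hy, h⟩
      refine ⟨((⟨_, hx⟩, ⟨_, hy⟩), ⟨_, G.add_mem _ hx _ hy⟩), ⟨⟨rfl, rfl⟩, h.symm⟩, rfl⟩
    · rintro ⟨⟨⟨x, y⟩, z⟩, ⟨⟨hx, hy⟩, hz⟩, h⟩
      obtain rfl : x + y = z := h
      change c ∘ Sum.inl ∘ Sum.inl ∈ G.carrier ∧ c ∘ Sum.inl ∘ Sum.inr ∈ G.carrier ∧
        G.add (c ∘ Sum.inl ∘ Sum.inl) (c ∘ Sum.inl ∘ Sum.inr) = c ∘ Sum.inr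
      have hx' : c ∘ Sum.inl ∘ Sum.inl = x := hx
      have hy' : c ∘ Sum.inl ∘ Sum.inr = y := hy
      rw [hx', hy']
      exact ⟨x.2, y.2, Eq.symm hz⟩

variable {G}

lemma coe_nsmul (n : ℕ) (x : G.carrier) : ((n • x : G.carrier) : Fin G.k → M) = G.nsmul n x := by
  induction n with
  | zero => rw [zero_nsmul]; rfl
  | succ n ih => rw [succ_nsmul', nsmul, ← ih]; rfl

lemma TorsionFree.eq_zero (h : G.TorsionFree) (n : ℕ) (x : G.carrier) (hn : n ≠ 0)
    (hx : n • x = 0) : x = 0 := by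
  obtain ⟨n, rfl⟩ := Nat.exists_eq_succ_of_ne_zero hn
  exact Subtype.ext (h x x.2 n ((coe_nsmul _ _).symm.trans (congrArg Subtype.val hx)))

lemma coe_sum {ι : Type} [Fintype ι] (f : ι → G.carrier) :
    ((∑ i, f i : G.carrier) : Fin G.k → M) = G.univSum fun i => f i := by
  rw [← Finset.sum_map_toList, univSum]
  induction (Finset.univ : Finset ι).toList with
  | nil => rfl
  | cons a l ih => rw [List.map_cons, List.sum_cons, List.map_cons, listSum, ← ih]; rfl

variable (G) in
/-- The set of tuples underlying a subgroup of the abstract group. -/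
def toSet (B : AddSubgroup G.carrier) : Set (Fin G.k → M) := Subtype.val '' (B : Set G.carrier)

lemma coe_mem_toSet {B : AddSubgroup G.carrier} {x : G.carrier} : (x : Fin G.k → M) ∈ G.toSet B ↔
    x ∈ B := Subtype.val_injective.mem_set_image

lemma toSet_top : G.toSet ⊤ = G.carrier := by
  simp [toSet]

lemma isSubgroup_toSet (B : AddSubgroup G.carrier) : G.IsSubgroup (G.toSet B) := by
  refine ⟨Subtype.coe_image_subset _ _, ⟨0, B.zero_mem, rfl⟩, ?_, ?_⟩
  · rintro _ ⟨x, hx, rfl⟩ _ ⟨y, hy, rfl⟩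
    exact ⟨x + y, B.add_mem hx hy, rfl⟩
  · rintro _ ⟨x, hx, rfl⟩
    exact ⟨-x, B.neg_mem hx, rfl⟩

lemma IsSubgroup.exists_toSet_eq {S : Set (Fin G.k → M)} (hS : G.IsSubgroup S) :
    ∃ B, G.toSet B = S :=
  ⟨{ carrier := {x | (x : Fin G.k → M) ∈ S}
     zero_mem' := hS.2.1
     add_mem' := fun hx hy => hS.2.2.1 _ hx _ hy
     neg_mem' := fun hx => hS.2.2.2 _ hx }, Subtype.image_preimage_val _ _ |>.trans
    (Set.inter_eq_right.2 hS.1)⟩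

lemma isInternalDirectSumOn_toSet {ι : Type} [Fintype ι] {B : ι → AddSubgroup G.carrier}
    {S : AddSubgroup G.carrier} :
    G.IsInternalDirectSumOn (G.toSet S) (fun i => G.toSet (B i)) ↔ IsDirect B S := by
  constructor
  · rintro ⟨hle, hsum, huniq⟩
    refine ⟨fun i x hx => coe_mem_toSet.1 ((hle i).2 (coe_mem_toSet.2 hx)), fun x hx => ?_,
      fun f hf h0 i => ?_⟩
    · obtain ⟨f, hf, hfx⟩ := hsum x (coe_mem_toSet.2 hx)
      choose g hg hgf using hf
      obtain rfl : (fun i => (g i : Fin G.k → M)) = f := funext hgf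
      exact ⟨g, hg, Subtype.ext ((coe_sum g).trans hfx)⟩
    · have := huniq (fun i => f i) (fun i => (0 : G.carrier)) (fun i => coe_mem_toSet.2 (hf i))
        (fun i => coe_mem_toSet.2 (B i).zero_mem) (by
          rw [← coe_sum, ← coe_sum, h0, Finset.sum_const_zero])
      exact Subtype.ext (congrFun this i)
  · intro h
    refine ⟨fun i => ⟨isSubgroup_toSet _, Set.image_mono (h.le i)⟩, ?_, fun f g hf hg hfg => ?_⟩
    · rintro _ ⟨x, hx, rfl⟩
      obtain ⟨f, hf, rfl⟩ := h.exists_sum x hx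
      exact ⟨fun i => f i, fun i => coe_mem_toSet.2 (hf i), (coe_sum f).symm⟩
    · choose f' hf' hff using hf
      choose g' hg' hgg using hg
      obtain rfl : (fun i => (f' i : Fin G.k → M)) = f := funext hff
      obtain rfl : (fun i => (g' i : Fin G.k → M)) = g := funext hgg
      rw [← coe_sum, ← coe_sum, Subtype.val_inj, ← sub_eq_zero, ← Finset.sum_sub_distrib] at hfg
      funext i
      rw [sub_eq_zero.1 (h.eq_zero _ (fun i => (B i).sub_mem (hf' i) (hg' i)) hfg i)]

lemma dp_mem_toSet {B : AddSubgroup G.carrier} : Dp L M (· ∈ B) ↔ Defin L M (G.toSet B) := by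
  refine iff_of_eq (congrArg (Defin L M) ?_)
  ext a
  exact ⟨fun ⟨x, hxa, hx⟩ => ⟨x, hx, Eq.symm hxa⟩, fun ⟨x, hx, hxa⟩ => ⟨x, Eq.symm hxa, hx⟩⟩

lemma isLine_iff [LinearOrder M] (hM : OMinimal L M) {B : AddSubgroup G.carrier} :
    IsLine L Subtype.val B ↔ Defin L M (G.toSet B) ∧ DimEq M (G.toSet B) 1 := by
  have hfib : ∀ j t, {x | x ∈ G.toSet B ∧ x j = t} =
      Subtype.val '' {x : G.carrier | x ∈ B ∧ (x : Fin G.k → M) j = t} := fun j t => by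
    ext x
    constructor
    · rintro ⟨⟨y, hy, rfl⟩, hx⟩
      exact ⟨y, ⟨hy, hx⟩, rfl⟩
    · rintro ⟨y, ⟨hy, hx⟩, rfl⟩
      exact ⟨⟨y, hy, rfl⟩, hx⟩
  have hdim : Defin L M (G.toSet B) → (DimEq M (G.toSet B) 1 ↔ {x | x ∈ B}.Infinite ∧
      ∀ j, {t | {x | x ∈ B ∧ (x : Fin G.k → M) j = t}.Infinite}.Finite) := fun h => by
    rw [hM.dimEq_one_iff (dp_mem_iff.2 h)]
    simp only [hfib, Set.infinite_image_iff Subtype.val_injective.injOn]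
    rw [toSet, Set.infinite_image_iff Subtype.val_injective.injOn]
    rfl
  constructor
  · intro h
    have := dp_mem_toSet.1 h.dp
    exact ⟨this, (hdim this).2 ⟨h.infinite, h.thin⟩⟩
  · rintro ⟨h, h'⟩
    obtain ⟨hinf, hthin⟩ := (hdim h).1 h'
    exact ⟨dp_mem_toSet.2 h, hinf, hthin⟩

end DefAbGroup

end Groups
end OMin

namespace OMin

/-- Let `(G, +)` be an abelian torsion-free definable group of
dimension `n` that is the direct sum of `n` one-dimensional definable subgroups.
Then every definable subgroup `H` of `G` is a direct sum of one-dimensional definable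
subgroups, and has a complement in `G` that is a direct sum of one-dimensional
definable subgroups. -/
theorem statement_15 {L : FirstOrder.Language} {M : Type} [L.Structure M] [LinearOrder M]
    (hM : OMinimal L M) (G : DefAbGroup L M) (htf : G.TorsionFree)
    (n : ℕ) (hdim : DimEq M G.carrier n)
    (A : Fin n → Set (Fin G.k → M))
    (hA : ∀ i, Defin L M (A i) ∧ DimEq M (A i) 1)
    (hsum : G.IsInternalDirectSum A) :
    ∀ H, G.IsSubgroup H → Defin L M H →
      (∃ (s : ℕ) (Hs : Fin s → Set (Fin G.k → M)),
        (∀ i, Defin L M (Hs i) ∧ DimEq M (Hs i) 1) ∧ G.IsInternalDirectSumOn H Hs) ∧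
      (∃ (m : ℕ) (B : Fin m → Set (Fin G.k → M)),
        (∀ i, Defin L M (B i) ∧ DimEq M (B i) 1) ∧
        G.IsInternalDirectSum (Fin.cons H B)) := by
  choose A' hA' using fun i => (hsum.1 i).1.exists_toSet_eq
  obtain rfl : (fun i => G.toSet (A' i)) = A := funext hA'
  intro H hH hHdef
  obtain ⟨H, rfl⟩ := hH.exists_toSet_eq
  have htop : ∀ {ι : Type} [Fintype ι] {B : ι → AddSubgroup G.carrier},
      (G.IsInternalDirectSum fun i => G.toSet (B i)) ↔ IsDirect B ⊤ := by
    intro ι _ B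
    rw [← DefAbGroup.isInternalDirectSumOn_toSet, DefAbGroup.toSet_top,
      DefAbGroup.IsInternalDirectSum]
  obtain ⟨⟨s, B, hB, hBH⟩, m, C, hC, hCH⟩ := hM.exists_splitting G.dmap_val
    Subtype.val_injective htf.eq_zero (fun i => (DefAbGroup.isLine_iff hM).2 (hA i))
    (htop.1 hsum) (DefAbGroup.dp_mem_toSet.2 hHdef)
  refine ⟨⟨s, fun i => G.toSet (B i), fun i => (DefAbGroup.isLine_iff hM).1 (hB i),
    DefAbGroup.isInternalDirectSumOn_toSet.2 hBH⟩, m, fun i => G.toSet (C i),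
    fun i => (DefAbGroup.isLine_iff hM).1 (hC i), ?_⟩
  convert htop.2 hCH using 1
  exact funext (Fin.forall_fin_succ.2 ⟨rfl, fun _ => rfl⟩)

end OMin
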